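/- Let M ≥ 1 be an integer, let α_k, β_k > 0 for k = 1,…,M, let m be a nonnegative integer, and suppose ∑_{k=1}^M α_k > m + (1/2)(M + 1/2) and λ ≥ π·∑_{k=1}^M β_k. Then ∫_0^∞ x^{2m}·J_{2m+1}(λx)·g_M(x) dx = ((2m)! / (2·∏_{k=1}^M Γ(α_k)^2)) · (2/λ)^{2m+1}. -/

import Mathlib

open MeasureTheory Real

/-- Bessel function of the first kind of nonnegative integer order `n`. -/
noncomputable def besselJ (n : ℕ) (x : ℝ) : ℝ :=
  ∑' k : ℕ, (-1 : ℝ) ^ k / (Nat.factorial k * Nat.factorial (n + k)) * (x / 2) ^ (n + 2 * k)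

/-- The product of reciprocal Gamma functions `∏_{k<M} 1/(Γ(α k + β k x) Γ(α k - β k x))`. -/
noncomputable def gammaProd (M : ℕ) (α β : ℕ → ℝ) (x : ℝ) : ℝ :=
  ∏ k ∈ Finset.range M, (Real.Gamma (α k + β k * x) * Real.Gamma (α k - β k * x))⁻¹

/-- The entire function `z ↦ 1/(Γ(α + z) Γ(α - z))`. -/
noncomputable def invGammaPair (α : ℝ) (z : ℂ) : ℂ :=
  (Complex.Gamma (α + z))⁻¹ * (Complex.Gamma (α - z))⁻¹

lemma differentiable_invGammaPair (α : ℝ) : Differentiable ℂ (invGammaPair α) := by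
  have h := Complex.differentiable_one_div_Gamma
  exact (h.comp (by fun_prop : Differentiable ℂ fun z : ℂ => (α : ℂ) + z)).mul
    (h.comp (by fun_prop : Differentiable ℂ fun z : ℂ => (α : ℂ) - z))

lemma invGammaPair_neg (α : ℝ) (z : ℂ) : invGammaPair α (-z) = invGammaPair α z := by
  simp only [invGammaPair, sub_neg_eq_add, ← sub_eq_add_neg]
  rw [mul_comm]

lemma invGammaPair_succ (α : ℝ) (z : ℂ) :
    invGammaPair α z = (α + z) * (α - z) * invGammaPair (α + 1) z := by
  have h1 := Complex.one_div_Gamma_eq_self_mul_one_div_Gamma_add_one (α + z)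
  have h2 := Complex.one_div_Gamma_eq_self_mul_one_div_Gamma_add_one (α - z)
  simp only [invGammaPair]
  rw [h1, h2]
  push_cast
  rw [show (α : ℂ) + z + 1 = α + 1 + z by ring, show (α : ℂ) - z + 1 = α + 1 - z by ring]
  ring

lemma invGammaPair_eq_sin_mul (α : ℝ) (z : ℂ) (h : Complex.Gamma (1 - α + z) ≠ 0) :
    invGammaPair α z = Complex.sin (π * (α - z)) / π *
      (Complex.Gamma (1 - α + z) * (Complex.Gamma (α + z))⁻¹) := by
  have h1 := Complex.Gamma_mul_Gamma_one_sub (α - z)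
  rw [show (1 : ℂ) - (α - z) = 1 - α + z by ring] at h1
  have h2 : (Complex.Gamma (α - z))⁻¹ =
      Complex.sin (π * (α - z)) / π * Complex.Gamma (1 - α + z) := by
    rw [eq_div_of_mul_eq h h1, inv_div, div_div_eq_mul_div]
    ring
  rw [invGammaPair, h2]
  ring

lemma norm_complex_sin_le (z : ℂ) : ‖Complex.sin z‖ ≤ rexp |z.im| := by
  have h : Complex.sin z = (Complex.exp (-z * Complex.I) - Complex.exp (z * Complex.I)) *
      Complex.I / 2 := rfl
  rw [h, norm_div, norm_mul, Complex.norm_I, mul_one]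
  have h1 : ‖Complex.exp (-z * Complex.I)‖ ≤ rexp |z.im| := by
    rw [Complex.norm_exp]; apply Real.exp_le_exp.mpr; simpa using le_abs_self z.im
  have h2 : ‖Complex.exp (z * Complex.I)‖ ≤ rexp |z.im| := by
    rw [Complex.norm_exp]; apply Real.exp_le_exp.mpr; simpa using neg_le_abs z.im
  have := norm_sub_le (Complex.exp (-z * Complex.I)) (Complex.exp (z * Complex.I))
  simp only [Complex.norm_ofNat]
  linarith

/-- Away from the imaginary axis the ratio `Γ(u)/Γ(u + c)` is bounded. -/
lemma norm_Gamma_mul_inv_Gamma_add_le {a c : ℝ} (ha : 0 < a) (hc : 0 < c) :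
    ∃ C, 0 ≤ C ∧ ∀ u : ℂ, a ≤ u.re →
      ‖Complex.Gamma u * (Complex.Gamma (u + c))⁻¹‖ ≤ C := by
  have hcc : 0 < (c : ℂ).re := by simpa
  have hac : 0 < (a : ℂ).re := by simpa
  refine ⟨(∫ x : ℝ in (0)..1, ‖(x : ℂ) ^ ((a : ℂ) - 1) * (1 - (x : ℂ)) ^ ((c : ℂ) - 1)‖) /
    ‖Complex.Gamma c‖, ?_, ?_⟩
  · apply div_nonneg _ (norm_nonneg _)
    apply intervalIntegral.integral_nonneg zero_le_one
    intros; positivity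
  intro u hu
  have hu0 : 0 < u.re := ha.trans_le hu
  have hG : Complex.Gamma c ≠ 0 := Complex.Gamma_ne_zero_of_re_pos hcc
  have hG2 : Complex.Gamma (u + c) ≠ 0 := Complex.Gamma_ne_zero_of_re_pos (by simp; linarith)
  have h := Complex.Gamma_mul_Gamma_eq_betaIntegral hu0 hcc
  have h2 : Complex.Gamma u * (Complex.Gamma (u + c))⁻¹ =
      Complex.betaIntegral u c / Complex.Gamma c := by
    field_simp
    rw [h]
  rw [h2, norm_div]
  gcongr
  rw [Complex.betaIntegral]
  refine intervalIntegral.norm_integral_le_of_norm_le zero_le_one ?_ ?_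
  · refine .of_forall fun x ⟨hx0, hx1⟩ => ?_
    rw [norm_mul, norm_mul]
    gcongr
    rw [Complex.norm_cpow_eq_rpow_re_of_pos hx0, Complex.norm_cpow_eq_rpow_re_of_pos hx0]
    apply Real.rpow_le_rpow_of_exponent_ge hx0 hx1
    simpa using hu
  · exact (Complex.betaIntegral_convergent hac hcc).norm

/-- Polynomial growth times `exp (π |Im z|)` for `invGammaPair`. -/
def GrowthPi (α : ℝ) : Prop :=
  ∃ C : ℝ, ∃ A : ℕ, 0 ≤ C ∧ ∀ z : ℂ, ‖invGammaPair α z‖ ≤ C * (1 + ‖z‖) ^ A * rexp (π * |z.im|)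

lemma growthPi_of_re_nonneg {α : ℝ} (h : ∃ C : ℝ, ∃ A : ℕ, 0 ≤ C ∧ ∀ z : ℂ, 0 ≤ z.re →
    ‖invGammaPair α z‖ ≤ C * (1 + ‖z‖) ^ A * rexp (π * |z.im|)) : GrowthPi α := by
  obtain ⟨C, A, hC, h⟩ := h
  refine ⟨C, A, hC, fun z => ?_⟩
  rcases le_total 0 z.re with hz | hz
  · exact h z hz
  · have := h (-z) (by simpa using hz)
    simpa [invGammaPair_neg] using this

lemma growthPi_zero : GrowthPi 0 := by
  refine ⟨1, 1, zero_le_one, fun z => ?_⟩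
  by_cases hz0 : z = 0
  · subst hz0; simp [invGammaPair]
  have key : invGammaPair 0 z = -z * (Complex.sin (π * z) / π) := by
    have h1 := Complex.Gamma_mul_Gamma_one_sub z
    have h2 := Complex.one_div_Gamma_eq_self_mul_one_div_Gamma_add_one (-z)
    simp only [invGammaPair, Complex.ofReal_zero, zero_add, zero_sub]
    rw [h2, show -z + 1 = 1 - z by ring, mul_left_comm, ← mul_inv, h1, inv_div]
  rw [key, norm_mul, norm_neg, norm_div]
  have h3 : ‖Complex.sin (π * z)‖ ≤ rexp (π * |z.im|) := by
    refine (norm_complex_sin_le _).trans_eq ?_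
    simp [abs_mul, abs_of_pos pi_pos]
  have h4 : ‖Complex.sin (π * z)‖ / ‖(π : ℂ)‖ ≤ rexp (π * |z.im|) := by
    refine (div_le_self (norm_nonneg _) ?_).trans h3
    rw [Complex.norm_real, Real.norm_of_nonneg pi_pos.le]
    linarith [pi_gt_three]
  rw [one_mul, pow_one]
  gcongr
  linarith

lemma growthPi_of_lt_one {α : ℝ} (h0 : 0 < α) (h1 : α < 1) : GrowthPi α := by
  obtain ⟨C, hC, hb⟩ := norm_Gamma_mul_inv_Gamma_add_le (a := 1 - α) (c := 2 * α)
    (by linarith) (by linarith)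
  refine growthPi_of_re_nonneg ⟨C, 1, hC, fun z hz => ?_⟩
  have hre : 0 < (1 - α + z : ℂ).re := by simp; linarith
  rw [invGammaPair_eq_sin_mul α z (Complex.Gamma_ne_zero_of_re_pos hre),
    Complex.one_div_Gamma_eq_self_mul_one_div_Gamma_add_one (α + z)]
  have e1 := hb (1 - α + z) (by simp; linarith)
  rw [show (1 - α + z + (2 * α : ℝ) : ℂ) = α + z + 1 by push_cast; ring] at e1
  have h3 : ‖Complex.sin (π * (α - z))‖ ≤ rexp (π * |z.im|) := by
    refine (norm_complex_sin_le _).trans_eq ?_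
    simp [abs_mul, abs_of_pos pi_pos]
  have h4 : ‖Complex.sin (π * (α - z)) / π‖ ≤ rexp (π * |z.im|) := by
    rw [norm_div]
    refine (div_le_self (norm_nonneg _) ?_).trans h3
    rw [Complex.norm_real, Real.norm_of_nonneg pi_pos.le]
    linarith [pi_gt_three]
  have h5 : ‖(α : ℂ) + z‖ ≤ 1 + ‖z‖ := by
    refine (norm_add_le _ _).trans ?_
    rw [Complex.norm_real, Real.norm_of_nonneg h0.le]
    linarith
  rw [mul_left_comm (Complex.Gamma _), norm_mul, norm_mul]
  calc _ ≤ rexp (π * |z.im|) * ((1 + ‖z‖) * C) := by gcongr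
    _ = _ := by ring

lemma growthPi_succ {α : ℝ} (h0 : 0 ≤ α) (h : GrowthPi α) : GrowthPi (α + 1) := by
  obtain ⟨C, A, hC, h⟩ := h
  obtain ⟨D, hD⟩ := (isCompact_closedBall (0 : ℂ) (α + 1)).exists_bound_of_continuousOn
    (differentiable_invGammaPair (α + 1)).continuous.continuousOn
  refine ⟨max C D, A, hC.trans (le_max_left _ _), fun z => ?_⟩
  have hexp : 1 ≤ rexp (π * |z.im|) := Real.one_le_exp (by positivity)
  have hpow : 1 ≤ (1 + ‖z‖) ^ A := one_le_pow₀ (by linarith [norm_nonneg z])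
  rcases le_total ‖z‖ (α + 1) with hz | hz
  · have h1 := (hD z (by simpa using hz)).trans (le_max_right C D)
    have hm : 0 ≤ max C D := hC.trans (le_max_left _ _)
    calc _ ≤ max C D * 1 * 1 := by simpa using h1
      _ ≤ _ := by gcongr
  · have h2 := h z
    rw [invGammaPair_succ, norm_mul, norm_mul] at h2
    have hα : ‖(α : ℂ)‖ = α := by rw [Complex.norm_real, Real.norm_of_nonneg h0]
    have h3 : 1 ≤ ‖(α : ℂ) + z‖ := by
      have := norm_sub_norm_le z (-(α : ℂ))
      rw [norm_neg, hα, sub_neg_eq_add, add_comm z] at this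
      linarith
    have h4 : 1 ≤ ‖(α : ℂ) - z‖ := by
      have := norm_sub_norm_le z (α : ℂ)
      rw [hα, norm_sub_rev] at this
      linarith
    calc _ ≤ ‖(α : ℂ) + z‖ * ‖(α : ℂ) - z‖ * ‖invGammaPair (α + 1) z‖ :=
          le_mul_of_one_le_left (norm_nonneg _) (one_le_mul_of_one_le_of_one_le h3 h4)
      _ ≤ _ := h2
      _ ≤ _ := by gcongr; exact le_max_left _ _

lemma growthPi {α : ℝ} (h0 : 0 ≤ α) : GrowthPi α := by
  have key : ∀ n : ℕ, GrowthPi (Int.fract α + n) := by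
    intro n
    induction n with
    | zero =>
      rw [Nat.cast_zero, add_zero]
      rcases (Int.fract_nonneg α).eq_or_lt with h | h
      · rw [← h]; exact growthPi_zero
      · exact growthPi_of_lt_one h (Int.fract_lt_one α)
    | succ n ih =>
      rw [Nat.cast_succ, ← add_assoc]
      exact growthPi_succ (by have := Int.fract_nonneg α; positivity) ih
  have h := key ⌊α⌋₊
  rwa [natCast_floor_eq_intCast_floor h0, Int.fract_add_floor] at h

lemma Real.Gamma_add_le_rpow_mul {x s : ℝ} (hx : 0 < x) (hs0 : 0 < s) (hs1 : s < 1) :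
    Real.Gamma (x + s) ≤ x ^ s * Real.Gamma x := by
  have h := Real.Gamma_mul_add_mul_le_rpow_Gamma_mul_rpow_Gamma hx (by linarith : 0 < x + 1)
    (by linarith : 0 < 1 - s) hs0 (by ring)
  rw [show (1 - s) * x + s * (x + 1) = x + s by ring, Real.Gamma_add_one hx.ne',
    Real.mul_rpow hx.le (Real.Gamma_pos_of_pos hx).le] at h
  refine h.trans_eq ?_
  rw [mul_left_comm, ← Real.rpow_add (Real.Gamma_pos_of_pos hx)]
  simp

/-- Sharp decay of `invGammaPair` on the nonnegative real axis. -/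
def DecayReal (α : ℝ) : Prop :=
  ∃ C : ℝ, 0 ≤ C ∧ ∀ x : ℝ, 0 ≤ x → ‖invGammaPair α x‖ ≤ C * (1 + x) ^ (1 - 2 * α)

lemma decayReal_of_le {α X C : ℝ}
    (h : ∀ x : ℝ, X ≤ x → 0 ≤ x → ‖invGammaPair α x‖ ≤ C * (1 + x) ^ (1 - 2 * α)) :
    DecayReal α := by
  have hc : ContinuousOn (fun x : ℝ => invGammaPair α x / ((1 + x) ^ (1 - 2 * α) : ℝ))
      (Set.Icc 0 X) := by
    apply ContinuousOn.div
    · exact ((differentiable_invGammaPair α).continuous.comp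
        Complex.continuous_ofReal).continuousOn
    · apply Complex.continuous_ofReal.comp_continuousOn
      apply ContinuousOn.rpow_const (by fun_prop)
      intro x hx
      left
      linarith [hx.1]
    · intro x hx
      have : 0 < 1 + x := by linarith [hx.1]
      exact_mod_cast (Real.rpow_pos_of_pos this _).ne'
  obtain ⟨D, hD⟩ := isCompact_Icc.exists_bound_of_continuousOn hc
  refine ⟨max (max C D) 0, le_max_right _ _, fun x hx => ?_⟩
  have hp : 0 < (1 + x) ^ (1 - 2 * α) := Real.rpow_pos_of_pos (by linarith) _
  rcases le_total X x with h1 | h1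
  · refine (h x h1 hx).trans ?_
    gcongr
    exact (le_max_left _ _).trans (le_max_left _ _)
  · have h2 := hD x ⟨hx, h1⟩
    rw [norm_div, Complex.norm_real, Real.norm_of_nonneg hp.le, div_le_iff₀ hp] at h2
    refine h2.trans ?_
    gcongr
    exact (le_max_right _ _).trans (le_max_left _ _)

lemma norm_sin_div_pi_le (x : ℝ) : ‖Complex.sin x / π‖ ≤ 1 := by
  rw [norm_div, Complex.norm_real, Real.norm_of_nonneg pi_pos.le, ← Complex.ofReal_sin,
    Complex.norm_real, Real.norm_eq_abs, div_le_one pi_pos]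
  exact (Real.abs_sin_le_one x).trans (by linarith [pi_gt_three])

lemma decayReal_zero : DecayReal 0 := by
  refine decayReal_of_le (X := 1) (C := 1) fun x hx _ => ?_
  have hG : Complex.Gamma (1 - (0 : ℝ) + x) ≠ 0 :=
    Complex.Gamma_ne_zero_of_re_pos (by simp; linarith)
  rw [invGammaPair_eq_sin_mul 0 x hG]
  have hx0 : (x : ℂ) ≠ 0 := by exact_mod_cast (by linarith : x ≠ 0)
  have hGx : Complex.Gamma x ≠ 0 := Complex.Gamma_ne_zero_of_re_pos (by simp; linarith)
  have : Complex.Gamma (1 - (0 : ℝ) + x) * (Complex.Gamma ((0 : ℝ) + x))⁻¹ = x := by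
    rw [Complex.ofReal_zero, sub_zero, zero_add, add_comm, Complex.Gamma_add_one _ hx0]
    field_simp
  rw [this, norm_mul, Complex.norm_real, Real.norm_of_nonneg (by linarith)]
  have h1 := norm_sin_div_pi_le (π * (0 - x))
  push_cast at h1 ⊢
  calc _ ≤ 1 * x := by gcongr
    _ ≤ _ := by simp

lemma decayReal_of_lt_one {α : ℝ} (h0 : 0 < α) (h1 : α < 1) : DecayReal α := by
  refine decayReal_of_le (X := 1) (C := 2 ^ α) fun x hx _ => ?_
  have hx0 : 0 < x := by linarith
  have hG : Complex.Gamma (1 - α + x) ≠ 0 :=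
    Complex.Gamma_ne_zero_of_re_pos (by simp; linarith)
  rw [invGammaPair_eq_sin_mul α x hG, norm_mul]
  have e1 := norm_sin_div_pi_le (π * (α - x))
  push_cast at e1
  have e2 : ‖Complex.Gamma (1 - α + x) * (Complex.Gamma (α + x))⁻¹‖ =
      Real.Gamma (x + (1 - α)) / Real.Gamma (x + α) := by
    rw [show (1 - α + x : ℂ) = ((x + (1 - α) : ℝ) : ℂ) by push_cast; ring,
      show (α + x : ℂ) = ((x + α : ℝ) : ℂ) by push_cast; ring, Complex.Gamma_ofReal,
      Complex.Gamma_ofReal, ← Complex.ofReal_inv, ← Complex.ofReal_mul, Complex.norm_real,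
      Real.norm_of_nonneg, div_eq_mul_inv]
    have := Real.Gamma_pos_of_pos (by linarith : 0 < x + (1 - α))
    have := Real.Gamma_pos_of_pos (by linarith : 0 < x + α)
    positivity
  have p1 := Real.Gamma_pos_of_pos hx0
  have p2 := Real.Gamma_pos_of_pos (by linarith : 0 < x + α)
  have w1 := Real.Gamma_add_le_rpow_mul hx0 (by linarith : 0 < 1 - α) (by linarith)
  have w2 := Real.Gamma_add_le_rpow_mul (by linarith : 0 < x + α) (by linarith : 0 < 1 - α)
    (by linarith)
  rw [show x + α + (1 - α) = x + 1 by ring, Real.Gamma_add_one hx0.ne'] at w2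
  have e3 : Real.Gamma (x + (1 - α)) / Real.Gamma (x + α) ≤
      x ^ (-α) * (x + α) ^ (1 - α) := by
    rw [div_le_iff₀ p2]
    calc _ ≤ x ^ (1 - α) * Real.Gamma x := w1
      _ = x ^ (-α) * (x * Real.Gamma x) := by
        rw [show 1 - α = -α + 1 by ring, Real.rpow_add hx0, Real.rpow_one]; ring
      _ ≤ x ^ (-α) * ((x + α) ^ (1 - α) * Real.Gamma (x + α)) := by gcongr
      _ = _ := by ring
  have e4 : x ^ (-α) ≤ 2 ^ α * (1 + x) ^ (-α) := by
    rw [Real.rpow_neg hx0.le, Real.rpow_neg (by linarith), ← div_eq_mul_inv, ← Real.div_rpow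
      (by norm_num) (by linarith), ← Real.inv_rpow hx0.le]
    gcongr
    rw [inv_eq_one_div, div_le_div_iff₀ hx0 (by linarith)]
    linarith
  calc _ ≤ 1 * (x ^ (-α) * (x + α) ^ (1 - α)) := by rw [e2]; gcongr
    _ ≤ 1 * ((2 ^ α * (1 + x) ^ (-α)) * (1 + x) ^ (1 - α)) := by
      gcongr ?_ * (?_ * ?_)
      apply Real.rpow_le_rpow <;> linarith
    _ = 2 ^ α * (1 + x) ^ (1 - 2 * α) := by
      rw [one_mul, mul_assoc, ← Real.rpow_add (by linarith)]
      ring_nf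

lemma decayReal_succ {α : ℝ} (h0 : 0 ≤ α) (h : DecayReal α) : DecayReal (α + 1) := by
  obtain ⟨C, hC, h⟩ := h
  refine decayReal_of_le (X := 2 * α + 1) (C := 4 * C) fun x hx hx0 => ?_
  have h2 := h x hx0
  rw [invGammaPair_succ, norm_mul] at h2
  have h3 : ‖((α : ℂ) + x) * (α - x)‖ = (x + α) * (x - α) := by
    rw [norm_mul, ← Complex.ofReal_add, ← Complex.ofReal_sub, Complex.norm_real,
      Complex.norm_real, Real.norm_of_nonneg (by linarith), Real.norm_of_nonpos (by linarith)]
    ring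
  have h4 : (1 + x) ^ 2 / 4 ≤ ‖((α : ℂ) + x) * (α - x)‖ := by
    rw [h3]
    nlinarith
  have h5 : (1 + x) ^ 2 / 4 * ‖invGammaPair (α + 1) x‖ ≤ C * (1 + x) ^ (1 - 2 * α) :=
    (mul_le_mul_of_nonneg_right h4 (norm_nonneg _)).trans h2
  have h6 : (1 + x) ^ (1 - 2 * α) = (1 + x) ^ 2 * (1 + x) ^ (1 - 2 * (α + 1)) := by
    rw [← Real.rpow_natCast, ← Real.rpow_add (by linarith)]
    congr 1
    push_cast
    ring
  rw [h6] at h5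
  have hp : 0 < (1 + x) ^ 2 := by positivity
  refine le_of_mul_le_mul_left ?_ hp
  linarith

lemma decayReal {α : ℝ} (h0 : 0 ≤ α) : DecayReal α := by
  have key : ∀ n : ℕ, DecayReal (Int.fract α + n) := by
    intro n
    induction n with
    | zero =>
      rw [Nat.cast_zero, add_zero]
      rcases (Int.fract_nonneg α).eq_or_lt with h | h
      · rw [← h]; exact decayReal_zero
      · exact decayReal_of_lt_one h (Int.fract_lt_one α)
    | succ n ih =>
      rw [Nat.cast_succ, ← add_assoc]
      exact decayReal_succ (by have := Int.fract_nonneg α; positivity) ih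
  have h := key ⌊α⌋₊
  rwa [natCast_floor_eq_intCast_floor h0, Int.fract_add_floor] at h

lemma integral_circleMap_inv_pow_mul_exp (N : ℕ) (c : ℂ) :
    ∫ θ in (0 : ℝ)..2 * π, ((circleMap 0 1 θ) ^ N)⁻¹ * Complex.exp (c * circleMap 0 1 θ) =
      2 * π / N.factorial * c ^ N := by
  have hd : Differentiable ℂ fun z : ℂ => Complex.exp (c * z) := by fun_prop
  have h := hd.diffContOnCl.circleIntegral_one_div_sub_center_pow_smul
    (c := 0) (R := 1) one_pos N
  rw [iteratedDeriv_cexp_const_mul, circleIntegral] at h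
  simp only [deriv_circleMap, sub_zero, smul_eq_mul, mul_zero, Complex.exp_zero, mul_one] at h
  have h2 : ∀ θ : ℝ, circleMap 0 1 θ * Complex.I * (1 / circleMap 0 1 θ ^ (N + 1) *
      Complex.exp (c * circleMap 0 1 θ)) =
      Complex.I * (((circleMap 0 1 θ) ^ N)⁻¹ * Complex.exp (c * circleMap 0 1 θ)) := by
    intro θ
    have : circleMap 0 1 θ ≠ 0 := circleMap_ne_center one_ne_zero
    field_simp
    ring
  simp only [h2] at h
  rw [intervalIntegral.integral_const_mul] at h
  apply mul_left_cancel₀ Complex.I_ne_zero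
  rw [h]
  ring

lemma exp_neg_mul_I_add_mul_sin (n : ℕ) (x θ : ℝ) :
    Complex.exp (-(n * θ - x * sin θ : ℝ) * Complex.I) =
      ((circleMap 0 1 θ) ^ n)⁻¹ * Complex.exp ((x / 2 : ℂ) * circleMap 0 1 θ) *
        Complex.exp ((-(x / 2) : ℂ) * (circleMap 0 1 θ)⁻¹) := by
  have hc : circleMap 0 1 θ = Complex.exp (θ * Complex.I) := by simp [circleMap]
  rw [hc, ← Complex.exp_neg, ← Complex.exp_nat_mul, ← Complex.exp_neg, ← Complex.exp_add,
    ← Complex.exp_add]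
  congr 1
  push_cast
  have h1 : Complex.exp (θ * Complex.I) - Complex.exp (-(θ * Complex.I)) =
      2 * Complex.I * Complex.sin θ := by
    rw [← neg_mul, Complex.exp_mul_I, Complex.exp_mul_I, Complex.cos_neg, Complex.sin_neg]
    ring
  linear_combination (-(x : ℂ) / 2) * h1

lemma integral_exp_neg_eq_besselJ (n : ℕ) (x : ℝ) :
    ∫ θ in (0 : ℝ)..2 * π, Complex.exp (-(n * θ - x * sin θ : ℝ) * Complex.I) =
      2 * π * besselJ n x := by
  have hs : Summable fun k : ℕ => ‖(-(x / 2) : ℂ)‖ ^ k / k.factorial :=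
    Real.summable_pow_div_factorial _
  have hnorm : ∀ θ : ℝ, ‖circleMap 0 1 θ‖ = 1 := fun θ => by simp [norm_circleMap_zero]
  have key := intervalIntegral.hasSum_integral_of_dominated_convergence (μ := volume)
    (a := 0) (b := 2 * π)
    (F := fun (k : ℕ) θ => ((-(x / 2) : ℂ) ^ k / k.factorial) * (((circleMap 0 1 θ) ^ (n + k))⁻¹ *
      Complex.exp ((x / 2 : ℂ) * circleMap 0 1 θ)))
    (f := fun θ : ℝ => Complex.exp (-(n * θ - x * sin θ : ℝ) * Complex.I))
    (fun k _ => ‖(-(x / 2) : ℂ)‖ ^ k / k.factorial * rexp |x / 2|) ?_ ?_ ?_ ?_ ?_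
  · simp only [intervalIntegral.integral_const_mul, integral_circleMap_inv_pow_mul_exp] at key
    rw [← key.tsum_eq, besselJ, Complex.ofReal_tsum, ← tsum_mul_left]
    congr 1
    ext k
    push_cast
    rw [neg_pow, pow_add _ n (2 * k), pow_add _ n k, pow_mul']
    have : (k.factorial : ℂ) ≠ 0 := by exact_mod_cast k.factorial_ne_zero
    have : ((n + k).factorial : ℂ) ≠ 0 := by exact_mod_cast (n + k).factorial_ne_zero
    field_simp
  · intro k
    apply Continuous.aestronglyMeasurable
    have : ∀ θ : ℝ, circleMap 0 1 θ ^ (n + k) ≠ 0 := fun θ =>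
      pow_ne_zero _ (circleMap_ne_center one_ne_zero)
    fun_prop (disch := assumption)
  · intro k
    refine .of_forall fun θ _ => ?_
    rw [norm_mul, norm_mul, norm_inv, norm_pow, hnorm, one_pow, inv_one, one_mul, norm_div,
      norm_pow, Complex.norm_natCast, Complex.norm_exp]
    gcongr
    refine (Complex.re_le_norm _).trans ?_
    rw [norm_mul, hnorm, mul_one]
    apply le_of_eq
    rw [← Real.norm_eq_abs, ← Complex.norm_real]
    push_cast
    rfl
  · exact .of_forall fun θ _ => hs.mul_right _
  · simp
  · refine .of_forall fun θ _ => ?_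
    rw [exp_neg_mul_I_add_mul_sin]
    have h1 := (NormedSpace.expSeries_div_hasSum_exp
      ((-(x / 2) : ℂ) * (circleMap 0 1 θ)⁻¹)).mul_left
      (((circleMap 0 1 θ) ^ n)⁻¹ * Complex.exp ((x / 2 : ℂ) * circleMap 0 1 θ))
    rw [← Complex.exp_eq_exp_ℂ] at h1
    refine Eq.mp (congrArg (fun f => HasSum f _) (funext fun k => ?_)) h1
    rw [mul_pow, inv_pow, pow_add, mul_inv]
    ring

lemma integral_exp_eq_besselJ (n : ℕ) (x : ℝ) :
    ∫ θ in (0 : ℝ)..2 * π, Complex.exp ((n * θ - x * sin θ : ℝ) * Complex.I) =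
      2 * π * besselJ n x := by
  have h := congrArg (starRingEnd ℂ) (integral_exp_neg_eq_besselJ n x)
  rw [← intervalIntegral.intervalIntegral_conj] at h
  simp only [map_mul, Complex.conj_ofReal, Complex.conj_ofNat, ← Complex.exp_conj, map_neg,
    Complex.conj_I, neg_mul_neg] at h
  exact h

lemma integral_cos_eq_besselJ (n : ℕ) (x : ℝ) :
    ∫ θ in (0 : ℝ)..2 * π, cos (n * θ - x * sin θ) = 2 * π * besselJ n x := by
  have h := congrArg Complex.re (integral_exp_eq_besselJ n x)
  rw [show (2 * π * besselJ n x : ℂ) = ((2 * π * besselJ n x : ℝ) : ℂ) by push_cast; rfl,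
    Complex.ofReal_re] at h
  rw [← h, ← Complex.reCLM_apply, ← ContinuousLinearMap.intervalIntegral_comp_comm]
  · simp only [Complex.reCLM_apply, Complex.exp_ofReal_mul_I_re]
  · apply Continuous.intervalIntegrable
    fun_prop

lemma abs_besselJ_le_one (n : ℕ) (x : ℝ) : |besselJ n x| ≤ 1 := by
  have h := intervalIntegral.norm_integral_le_of_norm_le_const (a := 0) (b := 2 * π) (C := 1)
    (f := fun θ => cos (n * θ - x * sin θ)) fun θ _ => Real.abs_cos_le_one _
  rw [integral_cos_eq_besselJ, sub_zero, one_mul, Real.norm_eq_abs, abs_mul] at h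
  exact le_of_mul_le_mul_left (h.trans_eq (mul_one _).symm) (abs_pos.mpr two_pi_pos.ne')

lemma hasDerivAt_intervalIntegral_of_bounded {F F' : ℝ → ℝ → ℝ} {a b C : ℝ} (x : ℝ)
    (hF : ∀ x, Continuous (F x)) (hF' : Continuous (F' x))
    (hb : ∀ x θ, |F' x θ| ≤ C) (hd : ∀ x θ, HasDerivAt (fun y => F y θ) (F' x θ) x) :
    HasDerivAt (fun y => ∫ θ in a..b, F y θ) (∫ θ in a..b, F' x θ) x :=
  (intervalIntegral.hasDerivAt_integral_of_dominated_loc_of_deriv_le (bound := fun _ => C)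
    Filter.univ_mem
    (.of_forall fun y => (hF y).aestronglyMeasurable)
    ((hF x).intervalIntegrable _ _) hF'.aestronglyMeasurable
    (.of_forall fun θ _ y _ => hb y θ) (by simp)
    (.of_forall fun θ _ y _ => hd y θ)).2

lemma hasDerivAt_integral_cos (n : ℕ) (x : ℝ) :
    HasDerivAt (fun y => ∫ θ in (0 : ℝ)..2 * π, cos (n * θ - y * sin θ))
      (∫ θ in (0 : ℝ)..2 * π, sin θ * sin (n * θ - x * sin θ)) x := by
  refine hasDerivAt_intervalIntegral_of_bounded (C := 1)
    (F' := fun x θ => sin θ * sin (n * θ - x * sin θ)) x (by fun_prop) (by fun_prop) ?_ ?_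
  · intro x θ
    rw [abs_mul]
    exact mul_le_one₀ (abs_sin_le_one _) (abs_nonneg _) (abs_sin_le_one _)
  · intro x θ
    refine (((hasDerivAt_id' x).mul_const (sin θ)).const_sub (n * θ)).cos.congr_deriv ?_
    ring

lemma hasDerivAt_integral_sin_mul_sin (n : ℕ) (x : ℝ) :
    HasDerivAt (fun y => ∫ θ in (0 : ℝ)..2 * π, sin θ * sin (n * θ - y * sin θ))
      (∫ θ in (0 : ℝ)..2 * π, -(sin θ ^ 2 * cos (n * θ - x * sin θ))) x := by
  refine hasDerivAt_intervalIntegral_of_bounded (C := 1)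
    (F' := fun x θ => -(sin θ ^ 2 * cos (n * θ - x * sin θ))) x (by fun_prop) (by fun_prop) ?_ ?_
  · intro x θ
    rw [abs_neg, abs_mul, abs_pow]
    exact mul_le_one₀ (pow_le_one₀ (abs_nonneg _) (abs_sin_le_one _)) (abs_nonneg _)
      (abs_cos_le_one _)
  · intro x θ
    refine (((((hasDerivAt_id' x).mul_const (sin θ)).const_sub (n * θ)).sin).const_mul
      (sin θ)).congr_deriv ?_
    ring

/-- Bessel's differential equation in terms of the integral representations. -/
lemma bessel_ode_integral (n : ℕ) (x : ℝ) :
    x ^ 2 * (∫ θ in (0 : ℝ)..2 * π, -(sin θ ^ 2 * cos (n * θ - x * sin θ))) +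
      x * (∫ θ in (0 : ℝ)..2 * π, sin θ * sin (n * θ - x * sin θ)) +
      (x ^ 2 - n ^ 2) * (∫ θ in (0 : ℝ)..2 * π, cos (n * θ - x * sin θ)) = 0 := by
  have hd : ∀ θ : ℝ, HasDerivAt (fun θ => -((n + x * cos θ) * sin (n * θ - x * sin θ)))
      (x ^ 2 * -(sin θ ^ 2 * cos (n * θ - x * sin θ)) + x * (sin θ * sin (n * θ - x * sin θ)) +
        (x ^ 2 - n ^ 2) * cos (n * θ - x * sin θ)) θ := by
    intro θ
    have h1 : HasDerivAt (fun θ => n * θ - x * sin θ) (n - x * cos θ) θ :=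
      (((hasDerivAt_id' θ).const_mul (n : ℝ)).fun_sub
        ((hasDerivAt_sin θ).const_mul x)).congr_deriv (by ring)
    have h2 : HasDerivAt (fun θ => n + x * cos θ) (x * -sin θ) θ :=
      ((hasDerivAt_cos θ).const_mul x).const_add _
    refine (h2.fun_mul h1.sin).fun_neg.congr_deriv ?_
    rw [Real.sin_sq]
    ring
  have hcont : Continuous fun θ : ℝ => x ^ 2 * -(sin θ ^ 2 * cos (n * θ - x * sin θ)) +
      x * (sin θ * sin (n * θ - x * sin θ)) + (x ^ 2 - n ^ 2) * cos (n * θ - x * sin θ) := by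
    fun_prop
  have h := intervalIntegral.integral_eq_sub_of_hasDerivAt (a := 0) (b := 2 * π)
    (fun θ _ => hd θ) (hcont.intervalIntegrable _ _)
  rw [← intervalIntegral.integral_const_mul, ← intervalIntegral.integral_const_mul,
    ← intervalIntegral.integral_const_mul, ← intervalIntegral.integral_add,
    ← intervalIntegral.integral_add, h]
  · have : sin (n * (2 * π)) = 0 := by
      have := Real.sin_nat_mul_pi (2 * n)
      push_cast at this
      rw [← this]
      ring_nf
    simp [this]
  all_goals
    apply Continuous.intervalIntegrable
    fun_prop

/-- A solution of Bessel's equation is `O(x ^ (-1/2))`, by a Gronwall estimate for the energy of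
`√x y(x)`. -/
lemma bounded_of_bessel_ode {y y' y'' : ℝ → ℝ} {c : ℝ}
    (h1 : ∀ x, HasDerivAt y (y' x) x) (h2 : ∀ x, HasDerivAt y' (y'' x) x)
    (hode : ∀ x, x ^ 2 * y'' x + x * y' x + (x ^ 2 - c) * y x = 0) :
    ∃ C, ∀ x, 1 ≤ x → x * y x ^ 2 ≤ C := by
  let E : ℝ → ℝ := fun x => x * y' x ^ 2 + y x * y' x + y x ^ 2 / (4 * x) + x * y x ^ 2
  let K : ℝ := |c - 1 / 4|
  have hE : ∀ x, 0 < x → HasDerivAt E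
      (2 * (x * y' x * y x + y x ^ 2 / 2) * (c - 1 / 4) / x ^ 2) x := by
    intro x hx
    have hy'' : y'' x = -(x * y' x + (x ^ 2 - c) * y x) / x ^ 2 := by
      have := hode x
      field_simp
      linarith
    have d1 := ((hasDerivAt_id x).mul ((h2 x).pow 2))
    have d2 := (h1 x).mul (h2 x)
    have d3 := ((h1 x).pow 2).div ((hasDerivAt_id x).const_mul 4) (by simp; exact hx.ne')
    have d4 := (hasDerivAt_id x).mul ((h1 x).pow 2)
    refine (((d1.add d2).add d3).add d4).congr_deriv ?_
    simp only [id, Pi.pow_apply]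
    rw [hy'']
    field_simp
    ring
  have hsq : ∀ x, 0 < x → E x = (x * y' x + y x / 2) ^ 2 / x + x * y x ^ 2 := by
    intro x hx
    simp only [E]
    field_simp
    ring
  have hanti : AntitoneOn (fun x => E x * rexp (K / x)) (Set.Ici 1) := by
    have hd : ∀ x, 0 < x → HasDerivAt (fun x => E x * rexp (K / x))
        ((2 * (x * y' x * y x + y x ^ 2 / 2) * (c - 1 / 4) / x ^ 2) * rexp (K / x) +
          E x * (rexp (K / x) * (-K / x ^ 2))) x := by
      intro x hx
      refine (hE x hx).mul ?_
      refine HasDerivAt.exp ?_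
      refine ((hasDerivAt_const x K).div (hasDerivAt_id x) hx.ne').congr_deriv ?_
      simp
    apply antitoneOn_of_deriv_nonpos (convex_Ici 1)
    · intro x hx
      exact (hd x (by linarith [hx.out])).continuousAt.continuousWithinAt
    · intro x hx
      rw [interior_Ici] at hx
      exact (hd x (by linarith [hx.out])).differentiableAt.differentiableWithinAt
    · intro x hx
      rw [interior_Ici] at hx
      have hx0 : 0 < x := by linarith [hx.out]
      rw [(hd x hx0).deriv]
      have hle : 2 * (x * y' x * y x + y x ^ 2 / 2) * (c - 1 / 4) ≤ K * E x := by
        have e1 : |2 * (x * y' x * y x + y x ^ 2 / 2)| ≤ E x := by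
          rw [hsq x hx0, abs_le]
          set p := x * y' x + y x / 2 with hp
          have e2 : x * y' x * y x + y x ^ 2 / 2 = p * y x := by rw [hp]; ring
          rw [e2]
          have e3 : p ^ 2 / x + x * y x ^ 2 - 2 * (p * y x) = (p - x * y x) ^ 2 / x := by
            field_simp; ring
          have e4 : p ^ 2 / x + x * y x ^ 2 + 2 * (p * y x) = (p + x * y x) ^ 2 / x := by
            field_simp; ring
          have := div_nonneg (sq_nonneg (p - x * y x)) hx0.le
          have := div_nonneg (sq_nonneg (p + x * y x)) hx0.le
          constructor <;> linarith
        calc _ ≤ |2 * (x * y' x * y x + y x ^ 2 / 2) * (c - 1 / 4)| := le_abs_self _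
          _ = |2 * (x * y' x * y x + y x ^ 2 / 2)| * K := abs_mul _ _
          _ ≤ E x * K := by gcongr
          _ = _ := mul_comm _ _
      have : 2 * (x * y' x * y x + y x ^ 2 / 2) * (c - 1 / 4) / x ^ 2 * rexp (K / x) +
          E x * (rexp (K / x) * (-K / x ^ 2)) =
          (2 * (x * y' x * y x + y x ^ 2 / 2) * (c - 1 / 4) - K * E x) / x ^ 2 * rexp (K / x) := by
        ring
      rw [this]
      apply mul_nonpos_of_nonpos_of_nonneg _ (Real.exp_pos _).le
      exact div_nonpos_of_nonpos_of_nonneg (by linarith) (by positivity)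
  refine ⟨E 1 * rexp (K / 1), fun x hx => ?_⟩
  have hx0 : 0 < x := by linarith
  have h := hanti Set.self_mem_Ici hx hx
  refine le_trans ?_ h
  have hEx : x * y x ^ 2 ≤ E x := by
    rw [hsq x hx0]
    have : 0 ≤ (x * y' x + y x / 2) ^ 2 / x := by positivity
    linarith
  refine hEx.trans (le_mul_of_one_le_right ?_ (Real.one_le_exp (by positivity)))
  exact le_trans (by positivity) hEx

lemma exists_abs_besselJ_le (n : ℕ) :
    ∃ C, 0 ≤ C ∧ ∀ x, 0 < x → |besselJ n x| ≤ C * x ^ (-(1 / 2) : ℝ) := by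
  obtain ⟨C, hC⟩ := bounded_of_bessel_ode (hasDerivAt_integral_cos n)
    (hasDerivAt_integral_sin_mul_sin n) (bessel_ode_integral n)
  refine ⟨max 1 √C, zero_le_one.trans (le_max_left _ _), fun x hx => ?_⟩
  rw [Real.rpow_neg hx.le, ← Real.sqrt_eq_rpow]
  have hsx : 0 < √x := Real.sqrt_pos.mpr hx
  rw [← div_eq_mul_inv, le_div_iff₀ hsx]
  rcases le_total x 1 with h1 | h1
  · refine le_trans ?_ (le_max_left _ _)
    exact mul_le_one₀ (abs_besselJ_le_one n x) hsx.le (Real.sqrt_le_one.mpr h1)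
  · refine le_trans (Real.le_sqrt_of_sq_le ?_) (le_max_right _ _)
    rw [mul_pow, sq_abs, Real.sq_sqrt hx.le]
    have h := hC x h1
    rw [integral_cos_eq_besselJ] at h
    refine le_trans ?_ h
    have h2 : 1 ≤ (2 * π) ^ 2 := one_le_pow₀ (by linarith [pi_gt_three])
    rw [mul_pow]
    nlinarith [mul_nonneg hx.le (sq_nonneg (besselJ n x))]

lemma continuous_besselJ (n : ℕ) : Continuous (besselJ n) := by
  have h : Continuous fun x => ∫ θ in (0 : ℝ)..2 * π, cos (n * θ - x * sin θ) :=
    continuous_iff_continuousAt.mpr fun x => (hasDerivAt_integral_cos n x).continuousAt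
  have h2 : besselJ n = fun x =>
      (2 * π)⁻¹ * ∫ θ in (0 : ℝ)..2 * π, cos (n * θ - x * sin θ) := by
    ext x
    rw [integral_cos_eq_besselJ, inv_mul_cancel_left₀ two_pi_pos.ne']
  rw [h2]
  exact h.const_mul _

lemma integral_circleMap_pow_div (n : ℕ) {a b : ℂ} (ha : ‖a‖ < 1) (hb : 1 < ‖b‖) :
    ∫ θ in (0 : ℝ)..2 * π, circleMap 0 1 θ ^ (n + 1) /
      ((circleMap 0 1 θ - a) * (circleMap 0 1 θ - b)) = 2 * π * (a ^ n / (a - b)) := by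
  have hne : ∀ z ∈ Metric.closedBall (0 : ℂ) 1, z - b ≠ 0 := by
    intro z hz h
    rw [sub_eq_zero.1 h, mem_closedBall_zero_iff] at hz
    linarith
  have hd : DiffContOnCl ℂ (fun z : ℂ => z ^ n / (z - b)) (Metric.ball 0 1) := by
    apply DifferentiableOn.diffContOnCl_ball (U := Metric.closedBall 0 1) _ le_rfl
    intro z hz
    exact ((differentiableAt_id.pow n).div (differentiableAt_id.sub_const b)
      (hne z hz)).differentiableWithinAt
  have h := hd.circleIntegral_sub_inv_smul (w := a) (by simpa using ha)
  rw [circleIntegral] at h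
  simp only [deriv_circleMap, smul_eq_mul] at h
  have h2 : ∀ θ : ℝ, circleMap 0 1 θ * Complex.I * ((circleMap 0 1 θ - a)⁻¹ *
      (circleMap 0 1 θ ^ n / (circleMap 0 1 θ - b))) =
      Complex.I * (circleMap 0 1 θ ^ (n + 1) /
        ((circleMap 0 1 θ - a) * (circleMap 0 1 θ - b))) := by
    intro θ
    rw [div_eq_mul_inv, div_eq_mul_inv, mul_inv]
    ring
  simp only [h2] at h
  rw [intervalIntegral.integral_const_mul] at h
  apply mul_left_cancel₀ Complex.I_ne_zero
  rw [h]
  ring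

lemma laplace_besselJ_eq_integral (n : ℕ) (lam : ℝ) {s : ℂ} (hs : 0 < s.re) :
    2 * π * ∫ x in Set.Ioi (0 : ℝ), Complex.exp (-s * x) * besselJ n (lam * x) =
      ∫ θ in (0 : ℝ)..2 * π,
        Complex.exp ((n * θ : ℝ) * Complex.I) / (s + (lam * sin θ : ℝ) * Complex.I) := by
  rw [← integral_const_mul]
  set F : ℝ → ℝ → ℂ := fun x θ =>
    Complex.exp (-s * x) * Complex.exp ((n * θ - lam * x * sin θ : ℝ) * Complex.I) with hF
  have h1 : ∀ x : ℝ, 2 * π * (Complex.exp (-s * x) * besselJ n (lam * x)) =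
      ∫ θ in (0 : ℝ)..2 * π, F x θ := by
    intro x
    rw [hF, intervalIntegral.integral_const_mul, integral_exp_eq_besselJ]
    ring
  simp only [h1]
  rw [← intervalIntegral_integral_swap (f := fun θ x => F x θ)]
  · refine intervalIntegral.integral_congr fun θ _ => ?_
    have h3 : ∀ x : ℝ, F x θ = Complex.exp ((n * θ : ℝ) * Complex.I) *
        Complex.exp (-(s + (lam * sin θ : ℝ) * Complex.I) * x) := by
      intro x
      rw [hF]
      simp only
      rw [← Complex.exp_add, ← Complex.exp_add]
      push_cast
      ring_nf
    simp only [h3]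
    rw [integral_const_mul, integral_exp_mul_complex_Ioi]
    · rw [Complex.ofReal_zero, mul_zero, Complex.exp_zero, neg_div_neg_eq, mul_one_div]
    · simpa using hs
  · have hexp : Integrable (fun x : ℝ => Real.exp (-s.re * x)) (volume.restrict (Set.Ioi 0)) :=
      integrableOn_exp_mul_Ioi (by linarith) 0
    have hone : Integrable (fun _ : ℝ => (1 : ℝ)) (volume.restrict (Set.uIoc 0 (2 * π))) := by
      rw [Set.uIoc_of_le Real.two_pi_pos.le]
      exact integrable_const _
    refine (hone.mul_prod hexp).mono' ?_ (.of_forall fun z => ?_)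
    · apply Continuous.aestronglyMeasurable
      simp only [hF, Function.uncurry_def]
      fun_prop
    · simp only [hF, Function.uncurry_def, norm_mul, one_mul, Complex.norm_exp]
      simp

/-- The square root of `σ ^ 2 + 1` in the right half-plane. -/
noncomputable def besselRoot (σ : ℂ) : ℂ := Complex.exp (Complex.log (σ ^ 2 + 1) / 2)

lemma besselRoot_sq {σ : ℂ} (h : σ ^ 2 + 1 ≠ 0) : besselRoot σ ^ 2 = σ ^ 2 + 1 := by
  rw [besselRoot, ← Complex.exp_nat_mul]
  push_cast
  rw [mul_div_cancel₀ _ two_ne_zero, Complex.exp_log h]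

lemma besselRoot_re_pos {σ : ℂ} (h : σ ^ 2 + 1 ∈ Complex.slitPlane) : 0 < (besselRoot σ).re := by
  rw [besselRoot, Complex.exp_re]
  refine mul_pos (Real.exp_pos _) (Real.cos_pos_of_mem_Ioo ?_)
  have h1 := Complex.mem_slitPlane_iff_arg.1 h
  have h2 := Complex.neg_pi_lt_arg (σ ^ 2 + 1)
  have h3 := lt_of_le_of_ne (Complex.arg_le_pi (σ ^ 2 + 1)) h1.1
  have h4 : (Complex.log (σ ^ 2 + 1) / 2).im = (σ ^ 2 + 1).arg / 2 := by
    rw [← Complex.log_im]; simp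
  rw [h4]
  constructor <;> linarith

/-- The Laplace transform of `J_n(λ x)`. -/
lemma laplace_besselJ (n : ℕ) {lam : ℝ} (hl : 0 < lam) {σ : ℂ} (hs : 0 < σ.re)
    (h : σ ^ 2 + 1 ∈ Complex.slitPlane) :
    ∫ x in Set.Ioi (0 : ℝ), Complex.exp (-(lam * σ) * x) * besselJ n (lam * x) =
      (besselRoot σ - σ) ^ n / (lam * besselRoot σ) := by
  set r := besselRoot σ with hr
  have hr2 : r ^ 2 = σ ^ 2 + 1 := besselRoot_sq (Complex.slitPlane_ne_zero h)
  have hrpos : 0 < r.re := besselRoot_re_pos h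
  have hr0 : r ≠ 0 := fun h0 => by simp [h0] at hrpos
  have hl' : (lam : ℂ) ≠ 0 := by exact_mod_cast hl.ne'
  set a := r - σ with ha
  set b := -r - σ with hb
  have hab : a * b = -1 := by
    rw [ha, hb]
    linear_combination -hr2
  have ha0 : a ≠ 0 := fun h0 => by simp [h0] at hab
  have hb_eq : b = -a⁻¹ := by
    field_simp
    linear_combination hab
  have hna : 0 < ‖a‖ := norm_pos_iff.2 ha0
  have hN : 0 < Complex.normSq a := Complex.normSq_pos.2 ha0
  have hbre : b.re = -(a.re / Complex.normSq a) := by rw [hb_eq]; simp [Complex.inv_re]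
  have hbre1 : b.re = -r.re - σ.re := by rw [hb]; simp
  have hare1 : a.re = r.re - σ.re := by rw [ha]; simp
  have hare : 0 < a.re := by
    by_contra hcon
    have : a.re / Complex.normSq a ≤ 0 := div_nonpos_of_nonpos_of_nonneg (not_lt.1 hcon) hN.le
    linarith
  have hlt : Complex.normSq a < 1 := by
    by_contra hcon
    have : a.re / Complex.normSq a ≤ a.re := div_le_self hare.le (not_lt.1 hcon)
    linarith
  have hna1 : ‖a‖ < 1 := by
    rw [Complex.normSq_eq_norm_sq] at hlt
    nlinarith
  have hnb1 : 1 < ‖b‖ := by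
    rw [hb_eq, norm_neg, norm_inv]
    exact (one_lt_inv₀ hna).2 hna1
  have h1 := laplace_besselJ_eq_integral n lam (s := lam * σ) (by simpa using mul_pos hl hs)
  have h2 : ∀ θ : ℝ, Complex.exp ((n * θ : ℝ) * Complex.I) /
      (lam * σ + (lam * sin θ : ℝ) * Complex.I) = (2 / lam) * (circleMap 0 1 θ ^ (n + 1) /
      ((circleMap 0 1 θ - a) * (circleMap 0 1 θ - b))) := by
    intro θ
    have hw : circleMap 0 1 θ = Complex.exp (θ * Complex.I) := by simp [circleMap]
    set w := circleMap 0 1 θ with hwd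
    have hw0 : w ≠ 0 := circleMap_ne_center one_ne_zero
    have e1 : Complex.exp ((n * θ : ℝ) * Complex.I) = w ^ n := by
      rw [hw, ← Complex.exp_nat_mul]
      push_cast
      ring_nf
    have e2 : ((lam * sin θ : ℝ) : ℂ) * Complex.I = lam * ((w - w⁻¹) / 2) := by
      rw [hw, ← Complex.exp_neg]
      push_cast
      rw [Complex.sin]
      ring_nf
      rw [Complex.I_sq]
      ring_nf
    have e3 : lam * σ + lam * ((w - w⁻¹) / 2) = (lam / 2) * ((w - a) * (w - b)) / w := by
      field_simp
      rw [ha, hb]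
      linear_combination hr2
    rw [e1, e2, e3]
    rw [div_div_eq_mul_div, pow_succ, div_mul_eq_div_div, div_div_eq_mul_div]
    ring
  simp only [h2] at h1
  rw [intervalIntegral.integral_const_mul, integral_circleMap_pow_div n hna1 hnb1] at h1
  have h3 : a - b = 2 * r := by rw [ha, hb]; ring
  rw [h3] at h1
  have hpi : (2 * π : ℂ) ≠ 0 := by
    have := Real.pi_ne_zero
    simp [this]
  apply mul_left_cancel₀ hpi
  rw [h1]
  field_simp

/-- The quotient `(a ^ n - b ^ n) / (a - b)` for `a * b = -1` is a monic polynomial of degree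
`n - 1` in `a + b`; the statement handles two consecutive exponents. -/
lemma exists_polynomial_pow_sub_pow_aux (n : ℕ) : ∃ P Q : Polynomial ℂ,
    P.natDegree ≤ n + 1 ∧ P.coeff (n + 1) = 1 ∧ Q.natDegree ≤ n ∧ Q.coeff n = 1 ∧
    (∀ a b : ℂ, a * b = -1 → (a - b) * P.eval (a + b) = a ^ (n + 2) - b ^ (n + 2)) ∧
    ∀ a b : ℂ, a * b = -1 → (a - b) * Q.eval (a + b) = a ^ (n + 1) - b ^ (n + 1) := by
  induction n with
  | zero =>
    refine ⟨Polynomial.X, 1, by simp, by simp, by simp, by simp, fun a b _ => ?_, fun a b _ => ?_⟩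
    · simp
      ring
    · simp
  | succ n ih =>
    obtain ⟨P, Q, hP, hP1, hQ, hQ1, hPe, hQe⟩ := ih
    refine ⟨Polynomial.X * P + Q, P, ?_, ?_, hP, hP1, fun a b hab => ?_, hPe⟩
    · refine (Polynomial.natDegree_add_le _ _).trans (max_le ?_ (by omega))
      refine Polynomial.natDegree_mul_le.trans ?_
      rw [Polynomial.natDegree_X]
      omega
    · rw [Polynomial.coeff_add, Polynomial.coeff_X_mul, hP1,
        Polynomial.coeff_eq_zero_of_natDegree_lt (by omega), add_zero]
    · have h1 := hPe a b hab
      have h2 := hQe a b hab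
      simp only [Polynomial.eval_add, Polynomial.eval_mul, Polynomial.eval_X]
      linear_combination (a + b) * h1 + h2 + (a ^ (n + 1) - b ^ (n + 1)) * hab

lemma exists_polynomial_pow_sub_pow (n : ℕ) : ∃ Q : Polynomial ℂ,
    Q.natDegree ≤ n ∧ Q.coeff n = 1 ∧
    ∀ a b : ℂ, a * b = -1 → (a - b) * Q.eval (a + b) = a ^ (n + 1) - b ^ (n + 1) := by
  obtain ⟨P, Q, -, -, hQ, hQ1, -, hQe⟩ := exists_polynomial_pow_sub_pow_aux n
  exact ⟨Q, hQ, hQ1, hQe⟩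

/-- The entire function `sin z / z`. -/
noncomputable def entireSinc : ℂ → ℂ := dslope Complex.sin 0

lemma entireSinc_zero : entireSinc 0 = 1 := by
  simp [entireSinc, dslope_same]

lemma entireSinc_of_ne {z : ℂ} (hz : z ≠ 0) : entireSinc z = Complex.sin z / z := by
  rw [entireSinc, dslope_of_ne _ hz, slope_def_field]
  simp

lemma differentiable_entireSinc : Differentiable ℂ entireSinc := by
  rw [← differentiableOn_univ]
  exact (Complex.differentiableOn_dslope Filter.univ_mem).2
    Complex.differentiable_sin.differentiableOn

lemma entireSinc_neg (z : ℂ) : entireSinc (-z) = entireSinc z := by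
  rcases eq_or_ne z 0 with rfl | hz
  · simp
  · rw [entireSinc_of_ne hz, entireSinc_of_ne (neg_ne_zero.2 hz), Complex.sin_neg, neg_div_neg_eq]

lemma norm_entireSinc_ofReal_le (x : ℝ) : ‖entireSinc x‖ ≤ 1 := by
  rcases eq_or_ne x 0 with rfl | hx
  · simp [entireSinc_zero]
  · rw [entireSinc_of_ne (by exact_mod_cast hx), ← Complex.ofReal_sin, ← Complex.ofReal_div,
      Complex.norm_real, norm_div]
    exact div_le_one_of_le₀ (Real.abs_sin_le_abs) (abs_nonneg x)

lemma exists_norm_entireSinc_le : ∃ C, 0 ≤ C ∧ ∀ z : ℂ,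
    ‖entireSinc z‖ ≤ C * rexp |z.im| / (1 + ‖z‖) := by
  obtain ⟨K, hK⟩ := (isCompact_closedBall (0 : ℂ) 1).exists_bound_of_continuousOn
    differentiable_entireSinc.continuous.continuousOn
  have hK0 : 0 ≤ K := (norm_nonneg _).trans (hK 0 (by simp))
  refine ⟨2 * (K + 1), by positivity, fun z => ?_⟩
  have he : 1 ≤ rexp |z.im| := Real.one_le_exp (abs_nonneg _)
  have hz0 := norm_nonneg z
  rw [le_div_iff₀ (by positivity)]
  rcases le_total ‖z‖ 1 with hz | hz
  · have := hK z (by simpa using hz)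
    calc ‖entireSinc z‖ * (1 + ‖z‖) ≤ K * 2 := by gcongr; linarith
      _ ≤ 2 * (K + 1) * 1 := by linarith
      _ ≤ _ := by gcongr
  · have hzne : z ≠ 0 := fun h => by simp [h] at hz; linarith
    rw [entireSinc_of_ne hzne, norm_div]
    calc ‖Complex.sin z‖ / ‖z‖ * (1 + ‖z‖) ≤ rexp |z.im| / ‖z‖ * (‖z‖ + ‖z‖) := by
          gcongr
          exact norm_complex_sin_le z
      _ = 2 * rexp |z.im| := by field_simp; ring
      _ ≤ _ := by nlinarith

lemma integrable_of_norm_le_div_sq {f : ℝ → ℂ} (hf : Continuous f) {C : ℝ} (hC : 0 ≤ C)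
    (h : ∀ x, ‖f x‖ ≤ C / (1 + |x|) ^ 2) : Integrable f := by
  refine (integrable_inv_one_add_sq.const_mul C).mono' hf.aestronglyMeasurable
    (.of_forall fun x => (h x).trans ?_)
  rw [div_eq_mul_inv]
  gcongr
  nlinarith [sq_abs x, abs_nonneg x]

lemma integral_mul_exp_eq_zero_of_exponential_type {F : ℂ → ℂ} (hF : Differentiable ℂ F)
    {C L : ℝ} (hC : 0 ≤ C)
    (hb : ∀ z, ‖F z‖ ≤ C * rexp (L * |z.im|) / (1 + ‖z‖) ^ 2) {τ : ℝ} (hτ : L ≤ τ) :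
    ∫ x : ℝ, F x * Complex.exp (τ * x * Complex.I) = 0 := by
  set G : ℂ → ℂ := fun z => F z * Complex.exp (τ * z * Complex.I) with hG
  have hGd : Differentiable ℂ G := by fun_prop
  have hGb : ∀ z : ℂ, 0 ≤ z.im → ‖G z‖ ≤ C / (1 + ‖z‖) ^ 2 := by
    intro z hz
    rw [hG]
    simp only [norm_mul, Complex.norm_exp]
    have e1 : (τ * z * Complex.I).re = -(τ * z.im) := by simp
    rw [e1]
    calc ‖F z‖ * rexp (-(τ * z.im)) ≤ C * rexp (L * |z.im|) / (1 + ‖z‖) ^ 2 *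
          rexp (-(τ * z.im)) := by gcongr; exact hb z
      _ = C / (1 + ‖z‖) ^ 2 * rexp (L * z.im - τ * z.im) := by
          rw [abs_of_nonneg hz, sub_eq_add_neg, Real.exp_add]; ring
      _ ≤ C / (1 + ‖z‖) ^ 2 * 1 := by
          gcongr
          rw [Real.exp_le_one_iff]
          nlinarith
      _ = _ := mul_one _
  have hGi : Integrable fun x : ℝ => G x := by
    refine integrable_of_norm_le_div_sq
      (hGd.continuous.comp Complex.continuous_ofReal) hC fun x => ?_
    simpa using hGb x (by simp)
  have hlim := intervalIntegral_tendsto_integral hGi Filter.tendsto_neg_atTop_atBot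
    Filter.tendsto_id
  refine tendsto_nhds_unique hlim (squeeze_zero_norm' (a := fun T => 4 * C / T) ?_ ?_)
  · filter_upwards [Filter.eventually_gt_atTop 0] with T hT
    have hrect := Complex.integral_boundary_rect_eq_zero_of_differentiableOn G (-T : ℝ)
      (T + T * Complex.I) hGd.differentiableOn
    simp only [Complex.ofReal_re, Complex.ofReal_im, Complex.ofReal_zero, zero_mul, add_zero,
      Complex.add_re, Complex.mul_re, Complex.I_re, mul_zero, Complex.I_im, sub_self,
      Complex.add_im, Complex.mul_im, mul_one, zero_add, smul_eq_mul] at hrect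
    have far : ∀ z : ℂ, 0 ≤ z.im → T ≤ ‖z‖ → ‖G z‖ ≤ C / T ^ 2 := by
      intro z h1 h2
      refine (hGb z h1).trans ?_
      gcongr
      linarith
    have top : ‖∫ x : ℝ in (-T)..T, G (x + T * Complex.I)‖ ≤ C / T ^ 2 * |T - (-T)| := by
      refine intervalIntegral.norm_integral_le_of_norm_le_const fun x _ => far _ ?_ ?_
      · simpa using hT.le
      · refine le_trans ?_ (Complex.abs_im_le_norm _)
        simpa using le_abs_self T
    have side : ∀ ξ : ℝ, |ξ| = T →
        ‖∫ y : ℝ in (0 : ℝ)..T, G (ξ + y * Complex.I)‖ ≤ C / T ^ 2 * |T - 0| := by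
      intro ξ hξ
      refine intervalIntegral.norm_integral_le_of_norm_le_const fun y hy => far _ ?_ ?_
      · rw [Set.uIoc_of_le hT.le] at hy
        simpa using hy.1.le
      · refine le_trans ?_ (Complex.abs_re_le_norm _)
        simp [hξ]
    have s1 := side T (abs_of_pos hT)
    have s2 := side (-T) (by rw [abs_neg, abs_of_pos hT])
    have heq : ∫ x : ℝ in (-T)..T, G x = (∫ x : ℝ in (-T)..T, G (x + T * Complex.I)) -
        Complex.I * (∫ y : ℝ in (0 : ℝ)..T, G (T + y * Complex.I)) +
        Complex.I * (∫ y : ℝ in (0 : ℝ)..T, G ((-T : ℝ) + y * Complex.I)) := by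
      linear_combination hrect
    have hgoal : ‖∫ x : ℝ in (-T)..T, G x‖ ≤ 4 * C / T := by
      rw [heq]
      refine (norm_add_le _ _).trans ((add_le_add_left (norm_sub_le _ _) _).trans ?_)
      rw [norm_mul, norm_mul, Complex.norm_I, one_mul, one_mul]
      refine (add_le_add (add_le_add top s1) s2).trans (le_of_eq ?_)
      rw [abs_of_pos (by linarith), abs_of_pos (by linarith)]
      field_simp
      ring
    simpa using hgoal
  · exact Filter.Tendsto.const_div_atTop Filter.tendsto_id _

/-- A form of the Paley–Wiener theorem: an entire function of exponential type `L` with quadratic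
decay is the Fourier transform of a continuous function on `[-L, L]`. -/
lemma exists_integral_exp_of_exponential_type {F : ℂ → ℂ} (hF : Differentiable ℂ F)
    {C L : ℝ} (hC : 0 ≤ C)
    (hb : ∀ z, ‖F z‖ ≤ C * rexp (L * |z.im|) / (1 + ‖z‖) ^ 2) :
    ∃ φ : ℝ → ℂ, Continuous φ ∧
      ∀ x : ℝ, F x = ∫ t in (-L)..L, φ t * Complex.exp (t * x * Complex.I) := by
  set f : ℝ → ℂ := fun x => F x with hf
  have hfc : Continuous f := hF.continuous.comp Complex.continuous_ofReal
  have hfi : Integrable f := by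
    refine integrable_of_norm_le_div_sq hfc hC fun x => ?_
    simpa using hb x
  set φ : ℝ → ℂ := fun t => (2 * π : ℂ)⁻¹ * ∫ x : ℝ, f x * Complex.exp (-t * x * Complex.I) with hφ
  have hφc : Continuous φ := by
    refine continuous_const.mul (continuous_of_dominated (bound := fun x => ‖f x‖) ?_ ?_ hfi.norm ?_)
    · intro t
      exact Continuous.aestronglyMeasurable (by fun_prop)
    · intro t
      refine .of_forall fun x => ?_
      rw [norm_mul, Complex.norm_exp]
      simp
    · exact .of_forall fun x => by fun_prop
  have hφ0 : ∀ t : ℝ, L ≤ |t| → φ t = 0 := by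
    intro t ht
    rw [hφ]
    simp only
    rcases le_abs.1 ht with h | h
    · have := integral_mul_exp_eq_zero_of_exponential_type (F := fun z => F (-z)) (C := C) (L := L)
        (by fun_prop) hC (by simpa using fun z => hb (-z)) h
      rw [← integral_neg_eq_self] at this
      simp only [Complex.ofReal_neg, neg_neg, mul_neg, neg_mul] at this
      simp only [hf, neg_mul, this, mul_zero]
    · have := integral_mul_exp_eq_zero_of_exponential_type hF hC hb h
      push_cast at this
      rw [hf, this, mul_zero]
  have hsupp : Function.support φ ⊆ Set.Ioc (-L) L := by
    intro t ht
    by_contra hcon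
    refine ht (hφ0 t ?_)
    by_contra h
    have := abs_lt.1 (not_le.1 h)
    exact hcon ⟨this.1, this.2.le⟩
  have hφi : Integrable φ := by
    rw [← integrableOn_iff_integrable_of_support_subset hsupp]
    exact hφc.integrableOn_Ioc
  have hfour : ∀ w : ℝ, FourierTransform.fourier f w = 2 * π * φ (w * (2 * π)) := by
    intro w
    rw [Real.fourier_real_eq_integral_exp_smul, hφ]
    have : (π : ℂ) ≠ 0 := by exact_mod_cast Real.pi_ne_zero
    simp only
    rw [← mul_assoc, mul_inv_cancel₀ (by simp [this]), one_mul]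
    refine integral_congr_ae (.of_forall fun x => ?_)
    simp only [smul_eq_mul]
    rw [mul_comm]
    push_cast
    ring_nf
  have hfouri : Integrable (FourierTransform.fourier f) := by
    have : FourierTransform.fourier f = fun w : ℝ => 2 * π * φ (w * (2 * π)) := funext hfour
    rw [this]
    exact (hφi.comp_mul_right' Real.two_pi_pos.ne').const_mul _
  refine ⟨φ, hφc, fun x => ?_⟩
  have hinv := congrFun (hfc.fourierInv_fourier_eq hfi hfouri) x
  rw [Real.fourierInv_eq'] at hinv
  have hrhs : ∫ t in (-L)..L, φ t * Complex.exp (t * x * Complex.I) =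
      ∫ t : ℝ, φ t * Complex.exp (t * x * Complex.I) := by
    apply intervalIntegral.integral_eq_integral_of_support_subset
    exact (Function.support_mul_subset_left _ _).trans hsupp
  rw [hrhs]
  have hsub := Measure.integral_comp_mul_right
    (fun t : ℝ => φ t * Complex.exp (t * x * Complex.I)) (2 * π)
  rw [abs_of_pos (inv_pos.2 Real.two_pi_pos)] at hsub
  change f x = _
  rw [← hinv]
  have hpi : (2 * π : ℝ) ≠ 0 := Real.two_pi_pos.ne'
  have hstep : ∫ t : ℝ, φ t * Complex.exp (t * x * Complex.I) = (2 * π : ℝ) •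
      ∫ w : ℝ, φ (w * (2 * π)) * Complex.exp ((w * (2 * π) : ℝ) * x * Complex.I) := by
    rw [hsub, smul_smul, mul_inv_cancel₀ hpi, one_smul]
  rw [hstep, ← integral_smul]
  refine integral_congr_ae (.of_forall fun w => ?_)
  simp only [hfour, smul_eq_mul, Complex.real_smul]
  have : inner ℝ w x = w * x := by simp [mul_comm]
  rw [this]
  push_cast
  ring_nf

lemma iteratedDeriv_integral_mul_exp {φ : ℝ → ℂ} (hφ : Continuous φ) (L : ℝ) (j : ℕ) :
    iteratedDeriv j (fun x : ℝ => ∫ t in (-L)..L, φ t * Complex.exp (t * x * Complex.I)) =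
      fun x : ℝ => ∫ t in (-L)..L, (t * Complex.I) ^ j * φ t * Complex.exp (t * x * Complex.I) := by
  induction j with
  | zero => simp
  | succ j ih =>
    rw [iteratedDeriv_succ, ih]
    ext x
    have hb : ∀ᵐ t : ℝ, t ∈ Set.uIoc (-L) L → ∀ y ∈ (Set.univ : Set ℝ),
        ‖(t * Complex.I) ^ (j + 1) * φ t * Complex.exp (t * y * Complex.I)‖ ≤
          ‖(t * Complex.I) ^ (j + 1) * φ t‖ := by
      refine .of_forall fun t _ y _ => ?_
      rw [norm_mul _ (Complex.exp _), Complex.norm_exp]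
      simp
    refine (intervalIntegral.hasDerivAt_integral_of_dominated_loc_of_deriv_le Filter.univ_mem
      ?_ ?_ ?_ hb ?_ ?_).2.deriv
    · exact .of_forall fun y => Continuous.aestronglyMeasurable (by fun_prop)
    · exact Continuous.intervalIntegrable (by fun_prop) _ _
    · exact Continuous.aestronglyMeasurable (by fun_prop)
    · exact Continuous.intervalIntegrable (by fun_prop) _ _
    · refine .of_forall fun t _ y _ => ?_
      have h1 : HasDerivAt (fun y : ℝ => (t * y * Complex.I : ℂ)) (t * 1 * Complex.I) y :=
        ((Complex.ofRealCLM.hasDerivAt (x := y)).const_mul (t : ℂ)).mul_const Complex.I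
      refine (h1.cexp.const_mul ((t * Complex.I) ^ j * φ t)).congr_deriv ?_
      ring

lemma iteratedDeriv_comp_ofReal {H : ℂ → ℂ} (hH : Differentiable ℂ H) (j : ℕ) :
    iteratedDeriv j (fun x : ℝ => H x) = fun x : ℝ => iteratedDeriv j H x := by
  induction j with
  | zero => simp
  | succ j ih =>
    ext x
    rw [iteratedDeriv_succ, ih, iteratedDeriv_succ]
    have hd : Differentiable ℂ (iteratedDeriv j H) :=
      (hH.contDiff (n := ⊤)).differentiable_iteratedDeriv j (WithTop.coe_lt_top _)
    exact (hd x).hasDerivAt.comp_ofReal.deriv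

lemma iteratedDeriv_pow_mul_zero {G : ℂ → ℂ} (hG : Differentiable ℂ G) {N j : ℕ} (hj : j ≤ N) :
    iteratedDeriv j (fun z : ℂ => z ^ N * G z) 0 = if j = N then N.factorial * G 0 else 0 := by
  rw [iteratedDeriv_fun_mul (f := fun z => z ^ N) (by fun_prop) hG.contDiff.contDiffAt]
  simp only [iteratedDeriv_fun_pow_zero]
  rw [Finset.sum_eq_single j]
  · split_ifs <;> simp
  · intro i hi hij
    have : i < N := by
      have := Finset.mem_range.1 hi
      omega
    simp [this.ne]
  · simp

/-- The closed form of the Laplace transform of `J_n(λ x)` at `λ σ`. -/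
noncomputable def besselLaplace (n : ℕ) (lam : ℝ) (σ : ℂ) : ℂ :=
  (besselRoot σ - σ) ^ n / (lam * besselRoot σ)

lemma sq_add_one_mem_slitPlane {ε τ : ℝ} (hτ : |τ| < 1) :
    ((ε : ℂ) - τ * Complex.I) ^ 2 + 1 ∈ Complex.slitPlane := by
  left
  have h1 : τ ^ 2 < 1 := by rwa [sq_lt_one_iff_abs_lt_one]
  have h2 : (((ε : ℂ) - τ * Complex.I) ^ 2 + 1).re = ε ^ 2 - τ ^ 2 + 1 := by
    simp [pow_two]
  rw [h2]
  nlinarith [sq_nonneg ε]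

lemma continuousAt_besselLaplace (n : ℕ) {lam : ℝ} (hl : 0 < lam) {σ : ℂ}
    (h : σ ^ 2 + 1 ∈ Complex.slitPlane) : ContinuousAt (besselLaplace n lam) σ := by
  have h1 : ContinuousAt besselRoot σ := by
    unfold besselRoot
    refine Complex.continuous_exp.continuousAt.comp (ContinuousAt.div_const ?_ 2)
    exact ContinuousAt.clog (by fun_prop) h
  refine ((h1.sub continuousAt_id).pow n).div (continuousAt_const.mul h1) ?_
  exact mul_ne_zero (by exact_mod_cast hl.ne') (Complex.exp_ne_zero _)

lemma abs_div_lt_one {L lam t : ℝ} (hl : L < lam) (hlam : 0 < lam)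
    (ht : t ∈ Set.Icc (-L) L) : |t / lam| < 1 := by
  rw [abs_div, abs_of_pos hlam, div_lt_one hlam]
  exact (abs_le.2 ht).trans_lt hl

lemma continuousOn_besselLaplace (n : ℕ) {L lam : ℝ} (hlam : 0 < lam) (hl : L < lam) :
    ContinuousOn (fun p : ℝ × ℝ => besselLaplace n lam (p.1 - (p.2 / lam : ℝ) * Complex.I))
      (Set.Icc 0 1 ×ˢ Set.Icc (-L) L) := by
  intro p hp
  refine ContinuousAt.continuousWithinAt ?_
  refine ContinuousAt.comp (g := besselLaplace n lam)
    (continuousAt_besselLaplace n hlam (sq_add_one_mem_slitPlane (abs_div_lt_one hl hlam hp.2))) ?_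
  fun_prop

/-- The regularised Hankel transform of a band-limited function. -/
lemma integral_exp_mul_besselJ_mul {φ : ℝ → ℂ} (hφ : Continuous φ) (n : ℕ) {L lam ε : ℝ}
    (hL : 0 ≤ L) (hl : L < lam) (hε : 0 < ε) :
    ∫ x in Set.Ioi (0 : ℝ), rexp (-(lam * ε) * x) * (besselJ n (lam * x) *
      ∫ t in (-L)..L, φ t * Complex.exp (t * x * Complex.I)) =
    ∫ t in (-L)..L, φ t * besselLaplace n lam (ε - (t / lam : ℝ) * Complex.I) := by
  have hlam : 0 < lam := hL.trans_lt hl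
  have hlam' : (lam : ℂ) ≠ 0 := by exact_mod_cast hlam.ne'
  set F : ℝ → ℝ → ℂ := fun t x => rexp (-(lam * ε) * x) * (besselJ n (lam * x) *
      (φ t * Complex.exp (t * x * Complex.I))) with hF
  have h1 : ∀ x : ℝ, rexp (-(lam * ε) * x) * (besselJ n (lam * x) *
      ∫ t in (-L)..L, φ t * Complex.exp (t * x * Complex.I)) = ∫ t in (-L)..L, F t x := by
    intro x
    rw [hF, intervalIntegral.integral_const_mul, intervalIntegral.integral_const_mul]
  simp only [h1]
  rw [← intervalIntegral_integral_swap]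
  · refine intervalIntegral.integral_congr fun t ht => ?_
    rw [Set.uIcc_of_le (by linarith)] at ht
    rw [besselLaplace, ← laplace_besselJ n hlam (by simpa using hε)
      (sq_add_one_mem_slitPlane (abs_div_lt_one hl hlam ht)), ← integral_const_mul]
    refine integral_congr_ae (.of_forall fun x => ?_)
    simp only [hF]
    have e : -(lam * ((ε : ℂ) - (t / lam : ℝ) * Complex.I)) * x =
        ((-(lam * ε) * x : ℝ) : ℂ) + t * x * Complex.I := by
      push_cast
      field_simp
      ring
    rw [e, Complex.exp_add, Complex.ofReal_exp]
    ring
  · have hexp : Integrable (fun x : ℝ => rexp (-(lam * ε) * x)) (volume.restrict (Set.Ioi 0)) :=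
      integrableOn_exp_mul_Ioi (by simpa using mul_pos hlam hε) 0
    have hone : Integrable φ (volume.restrict (Set.uIoc (-L) L)) := hφ.integrableOn_uIoc
    have hJ := continuous_besselJ n
    refine (hone.norm.mul_prod hexp).mono' ?_ (.of_forall fun z => ?_)
    · apply Continuous.aestronglyMeasurable
      simp only [hF, Function.uncurry_def]
      fun_prop
    · simp only [hF, Function.uncurry_def, norm_mul, Complex.norm_real, Real.norm_eq_abs,
        Real.abs_exp]
      have e : ‖Complex.exp (z.1 * z.2 * Complex.I)‖ = 1 := by
        rw [Complex.norm_exp]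
        simp
      rw [e, mul_one]
      calc _ ≤ rexp (-(lam * ε) * z.2) * (1 * ‖φ z.1‖) := by
            gcongr
            exact abs_besselJ_le_one _ _
        _ = _ := by ring

/-- The Hankel transform of a band-limited function, as an integral over its spectrum. -/
lemma integral_besselJ_mul_eq_spectral {φ : ℝ → ℂ} (hφ : Continuous φ) (n : ℕ) {L lam : ℝ}
    (hL : 0 ≤ L) (hl : L < lam) {h : ℝ → ℂ} (hc : Continuous h) (hi : Integrable h)
    (hh : ∀ x : ℝ, h x = ∫ t in (-L)..L, φ t * Complex.exp (t * x * Complex.I)) :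
    ∫ x in Set.Ioi (0 : ℝ), besselJ n (lam * x) * h x =
      ∫ t in (-L)..L, φ t * besselLaplace n lam (-((t / lam : ℝ) * Complex.I)) := by
  have hlam : 0 < lam := hL.trans_lt hl
  have hcont := continuousOn_besselLaplace n hlam hl
  obtain ⟨K, hK⟩ := (isCompact_Icc.prod isCompact_Icc).exists_bound_of_continuousOn hcont
  have hJ := continuous_besselJ n
  have hpos : ∀ᶠ ε : ℝ in nhdsWithin 0 (Set.Ioi 0), 0 < ε := self_mem_nhdsWithin
  have hlt : ∀ᶠ ε : ℝ in nhdsWithin 0 (Set.Ioi 0), ε < 1 :=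
    nhdsWithin_le_nhds (Iio_mem_nhds one_pos)
  have lim1 : Filter.Tendsto (fun ε : ℝ => ∫ x in Set.Ioi (0 : ℝ), rexp (-(lam * ε) * x) *
      (besselJ n (lam * x) * h x)) (nhdsWithin 0 (Set.Ioi 0))
      (nhds (∫ x in Set.Ioi (0 : ℝ), besselJ n (lam * x) * h x)) := by
    refine tendsto_integral_filter_of_dominated_convergence (fun x => ‖h x‖) ?_ ?_
      hi.norm.integrableOn ?_
    · exact .of_forall fun ε => Continuous.aestronglyMeasurable (by fun_prop)
    · filter_upwards [hpos] with ε hε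
      refine (ae_restrict_iff' measurableSet_Ioi).2 (.of_forall fun x hx => ?_)
      rw [norm_mul, norm_mul, Complex.norm_real, Complex.norm_real, Real.norm_eq_abs,
        Real.norm_eq_abs, Real.abs_exp]
      have e1 : rexp (-(lam * ε) * x) ≤ 1 := by
        rw [Real.exp_le_one_iff]
        have := mul_pos (mul_pos hlam hε) hx
        linarith
      calc _ ≤ 1 * (1 * ‖h x‖) := by
            gcongr
            exact abs_besselJ_le_one _ _
        _ = _ := by ring
    · refine .of_forall fun x => ?_
      have hc0 : Continuous fun ε : ℝ => (rexp (-(lam * ε) * x) : ℂ) *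
        (besselJ n (lam * x) * h x) := by fun_prop
      have := (hc0.tendsto 0).mono_left (nhdsWithin_le_nhds (s := Set.Ioi 0))
      simpa using this
  have lim2 : Filter.Tendsto (fun ε : ℝ => ∫ t in (-L)..L,
      φ t * besselLaplace n lam (ε - (t / lam : ℝ) * Complex.I)) (nhdsWithin 0 (Set.Ioi 0))
      (nhds (∫ t in (-L)..L, φ t * besselLaplace n lam (-((t / lam : ℝ) * Complex.I)))) := by
    have hsub : ∀ t ∈ Set.uIoc (-L) L, t ∈ Set.Icc (-L) L := by
      intro t ht
      rw [Set.uIoc_of_le (by linarith)] at ht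
      exact ⟨ht.1.le, ht.2⟩
    refine intervalIntegral.tendsto_integral_filter_of_dominated_convergence
      (fun t => ‖φ t‖ * K) ?_ ?_ ?_ ?_
    · filter_upwards [hpos, hlt] with ε h0 h1
      refine ContinuousOn.aestronglyMeasurable ?_ measurableSet_uIoc
      refine hφ.continuousOn.mul (hcont.comp (f := fun t : ℝ => (ε, t)) (by fun_prop) ?_)
      exact fun t ht => ⟨⟨h0.le, h1.le⟩, hsub t ht⟩
    · filter_upwards [hpos, hlt] with ε h0 h1
      refine .of_forall fun t ht => ?_
      rw [norm_mul]
      gcongr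
      exact hK (ε, t) ⟨⟨h0.le, h1.le⟩, hsub t ht⟩
    · exact (hφ.norm.mul continuous_const).intervalIntegrable _ _
    · refine .of_forall fun t ht => ?_
      have hmem := sq_add_one_mem_slitPlane (ε := 0) (abs_div_lt_one hl hlam (hsub t ht))
      have hat : ContinuousAt (fun ε : ℝ =>
          besselLaplace n lam (ε - (t / lam : ℝ) * Complex.I)) 0 :=
        ContinuousAt.comp (g := besselLaplace n lam) (continuousAt_besselLaplace n hlam hmem)
          (by fun_prop)
      have := (hat.tendsto.mono_left (nhdsWithin_le_nhds (s := Set.Ioi 0))).const_mul (φ t)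
      simpa using this
  refine tendsto_nhds_unique lim1 (lim2.congr' ?_)
  filter_upwards [hpos] with ε hε
  simp only [hh]
  exact (integral_exp_mul_besselJ_mul hφ n hL hl hε).symm

lemma besselLaplace_add_besselLaplace_neg {m : ℕ} {Q : Polynomial ℂ}
    (hQ : ∀ a b : ℂ, a * b = -1 → (a - b) * Q.eval (a + b) = a ^ (2 * m + 1) - b ^ (2 * m + 1))
    {lam τ : ℝ} (hlam : 0 < lam) (hτ : |τ| < 1) :
    besselLaplace (2 * m + 1) lam (-(τ * Complex.I)) +
      besselLaplace (2 * m + 1) lam (τ * Complex.I) =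
      2 / lam * Q.eval (2 * (τ * Complex.I)) := by
  have hmem : (τ * Complex.I) ^ 2 + 1 ∈ Complex.slitPlane := by
    simpa using sq_add_one_mem_slitPlane (ε := 0) hτ
  have hlam' : (lam : ℂ) ≠ 0 := by exact_mod_cast hlam.ne'
  set s := (τ * Complex.I : ℂ)
  have hrneg : besselRoot (-s) = besselRoot s := by simp [besselRoot]
  have hr2 := besselRoot_sq (Complex.slitPlane_ne_zero hmem)
  have hr0 : besselRoot s ≠ 0 := Complex.exp_ne_zero _
  rw [besselLaplace, besselLaplace, hrneg]
  set r := besselRoot s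
  have h := hQ (r + s) (s - r) (by linear_combination -hr2)
  have e1 : r + s - (s - r) = 2 * r := by ring
  have e2 : r + s + (s - r) = 2 * s := by ring
  have e3 : (s - r) ^ (2 * m + 1) = -(r - s) ^ (2 * m + 1) := by
    rw [← neg_sub r s, Odd.neg_pow ⟨m, rfl⟩]
  rw [e1, e2, e3] at h
  rw [sub_neg_eq_add] at h ⊢
  rw [← add_div, ← h]
  field_simp

/-- The first-term evaluation for band-limited functions with spectrum inside `(-λ, λ)`. -/
lemma integral_besselJ_mul_of_exponential_type {G : ℂ → ℂ} (hG : Differentiable ℂ G)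
    (heven : ∀ z, G (-z) = G z) (m : ℕ) {C L lam : ℝ} (hC : 0 ≤ C) (hL : 0 ≤ L) (hl : L < lam)
    (hb : ∀ z, ‖z ^ (2 * m) * G z‖ ≤ C * rexp (L * |z.im|) / (1 + ‖z‖) ^ 2) :
    ∫ x in Set.Ioi (0 : ℝ), besselJ (2 * m + 1) (lam * x) * ((x : ℂ) ^ (2 * m) * G x) =
      (2 * m).factorial / 2 * (2 / lam) ^ (2 * m + 1) * G 0 := by
  have hlam : 0 < lam := hL.trans_lt hl
  have hlam' : (lam : ℂ) ≠ 0 := by exact_mod_cast hlam.ne'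
  have hFd : Differentiable ℂ fun z : ℂ => z ^ (2 * m) * G z := by fun_prop
  obtain ⟨φ, hφ, hrep⟩ := exists_integral_exp_of_exponential_type hFd hC hb
  obtain ⟨Q, hQdeg, hQlead, hQ⟩ := exists_polynomial_pow_sub_pow (2 * m)
  set h : ℝ → ℂ := fun x => (x : ℂ) ^ (2 * m) * G x with hh
  have hc : Continuous h := hFd.continuous.comp Complex.continuous_ofReal
  have hi : Integrable h := by
    refine integrable_of_norm_le_div_sq hc hC fun x => ?_
    simpa [hh] using hb x
  have hrep' : ∀ x : ℝ, h x = ∫ t in (-L)..L, φ (-t) * Complex.exp (t * x * Complex.I) := by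
    intro x
    have e : h x = h (-x) := by
      rw [hh]
      simp only [Complex.ofReal_neg, heven, Even.neg_pow ⟨m, two_mul m⟩]
    rw [e]
    change (((-x : ℝ) : ℂ) ^ (2 * m) * G ((-x : ℝ) : ℂ)) = _
    rw [hrep (-x), ← neg_neg L, ← intervalIntegral.integral_comp_neg, neg_neg]
    simp
  have i1 := integral_besselJ_mul_eq_spectral hφ (2 * m + 1) hL hl hc hi hrep
  have i2 := integral_besselJ_mul_eq_spectral (φ := fun t => φ (-t)) (by fun_prop)
    (2 * m + 1) hL hl hc hi hrep'
  have i3 : ∫ t in (-L)..L, φ (-t) * besselLaplace (2 * m + 1) lam (-((t / lam : ℝ) * Complex.I)) =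
      ∫ t in (-L)..L, φ t * besselLaplace (2 * m + 1) lam ((t / lam : ℝ) * Complex.I) := by
    conv_rhs => rw [← neg_neg L, ← intervalIntegral.integral_comp_neg, neg_neg]
    simp [neg_div]
  rw [i3] at i2
  have hcb : ∀ δ : ℝ, |δ| = 1 → IntervalIntegrable (fun t : ℝ => φ t *
      besselLaplace (2 * m + 1) lam (δ * ((t / lam : ℝ) * Complex.I))) volume (-L) L := by
    intro δ hδ
    refine ContinuousOn.intervalIntegrable (hφ.continuousOn.mul fun t ht => ?_)
    rw [Set.uIcc_of_le (by linarith)] at ht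
    refine ContinuousAt.continuousWithinAt (ContinuousAt.comp
      (g := besselLaplace (2 * m + 1) lam) (continuousAt_besselLaplace _ hlam ?_) (by fun_prop))
    have := sq_add_one_mem_slitPlane (ε := 0) (abs_div_lt_one hl hlam ht)
    have hδ2 : (δ : ℂ) ^ 2 = 1 := by
      rw [← Complex.ofReal_pow, ← sq_abs, hδ]
      simp
    rw [mul_pow, hδ2, one_mul]
    simpa using this
  have hmom : ∀ j ≤ 2 * m, ∫ t in (-L)..L, (t * Complex.I) ^ j * φ t =
      if j = 2 * m then ((2 * m).factorial : ℂ) * G 0 else 0 := by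
    intro j hj
    rw [← iteratedDeriv_pow_mul_zero hG hj]
    have e1 := congrFun (iteratedDeriv_comp_ofReal hFd j) 0
    have e2 := congrFun (iteratedDeriv_integral_mul_exp hφ L j) 0
    rw [← funext hrep, e1] at e2
    simpa using e2.symm
  have hsum : ∫ t in (-L)..L, φ t * (2 / lam * Q.eval (2 * ((t / lam : ℝ) * Complex.I))) =
      2 / lam * ((2 / lam) ^ (2 * m) * ((2 * m).factorial * G 0)) := by
    have e : ∀ t : ℝ, φ t * (2 / lam * Q.eval (2 * ((t / lam : ℝ) * Complex.I))) =
        ∑ j ∈ Finset.range (2 * m + 1),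
          2 / lam * (Q.coeff j * (2 / lam) ^ j) * ((t * Complex.I) ^ j * φ t) := by
      intro t
      rw [Polynomial.eval_eq_sum_range' (n := 2 * m + 1) (by omega), Finset.mul_sum,
        Finset.mul_sum]
      refine Finset.sum_congr rfl fun j _ => ?_
      have : 2 * (((t / lam : ℝ) : ℂ) * Complex.I) = 2 / lam * (t * Complex.I) := by
        push_cast
        field_simp
      rw [this, mul_pow]
      ring
    simp only [e]
    rw [intervalIntegral.integral_finsetSum]
    · simp only [intervalIntegral.integral_const_mul]
      rw [Finset.sum_eq_single (2 * m)]
      · rw [hmom _ le_rfl, if_pos rfl, hQlead]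
        ring
      · intro j hj hne
        have := Finset.mem_range.1 hj
        rw [hmom j (by omega), if_neg hne, mul_zero]
      · simp
    · intro j _
      exact Continuous.intervalIntegrable (by fun_prop) _ _
  have hadd : ∫ t in (-L)..L, (φ t * besselLaplace (2 * m + 1) lam (-((t / lam : ℝ) * Complex.I)) +
      φ t * besselLaplace (2 * m + 1) lam ((t / lam : ℝ) * Complex.I)) =
      ∫ t in (-L)..L, φ t * (2 / lam * Q.eval (2 * ((t / lam : ℝ) * Complex.I))) := by
    refine intervalIntegral.integral_congr fun t ht => ?_
    rw [Set.uIcc_of_le (by linarith)] at ht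
    rw [← mul_add, besselLaplace_add_besselLaplace_neg hQ hlam (abs_div_lt_one hl hlam ht)]
  rw [intervalIntegral.integral_add (by simpa using hcb (-1) (by simp))
    (by simpa using hcb 1 (by simp)), ← i1, ← i2, hsum] at hadd
  linear_combination hadd / 2

lemma integrableOn_rpow_neg_half_mul_one_add_rpow {q : ℝ} (hq : q < -(1 / 2)) :
    IntegrableOn (fun x : ℝ => x ^ (-(1 / 2) : ℝ) * (1 + x) ^ q) (Set.Ioi 0) := by
  rw [← Set.Ioc_union_Ioi_eq_Ioi zero_le_one]
  have hmeas : Measurable fun x : ℝ => x ^ (-(1 / 2) : ℝ) * (1 + x) ^ q := by fun_prop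
  refine IntegrableOn.union ?_ ?_
  · have h1 : IntegrableOn (fun x : ℝ => x ^ (-(1 / 2) : ℝ)) (Set.Ioc 0 1) :=
      (intervalIntegrable_iff_integrableOn_Ioc_of_le zero_le_one).1
        (intervalIntegral.intervalIntegrable_rpow' (by norm_num))
    refine Integrable.mono' h1 hmeas.aestronglyMeasurable
      ((ae_restrict_iff' measurableSet_Ioc).2 (.of_forall fun x hx => ?_))
    have hx0 : 0 < x := hx.1
    rw [Real.norm_of_nonneg (by positivity)]
    exact mul_le_of_le_one_right (by positivity)
      (Real.rpow_le_one_of_one_le_of_nonpos (by linarith) (by linarith))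
  · have h1 : IntegrableOn (fun x : ℝ => x ^ (-(1 / 2) + q : ℝ)) (Set.Ioi 1) :=
      integrableOn_Ioi_rpow_of_lt (by linarith) one_pos
    refine Integrable.mono' h1 hmeas.aestronglyMeasurable
      ((ae_restrict_iff' measurableSet_Ioi).2 (.of_forall fun x hx => ?_))
    have hx0 : 0 < x := one_pos.trans hx
    rw [Real.norm_of_nonneg (by positivity), Real.rpow_add hx0]
    exact mul_le_mul_of_nonneg_left
      (Real.rpow_le_rpow_of_nonpos hx0 (by linarith) (by linarith)) (by positivity)

lemma norm_mul_entireSinc_pow_le {G : ℂ → ℂ} {C L : ℝ} {A : ℕ} (hC : 0 ≤ C)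
    (hgrow : ∀ z, ‖G z‖ ≤ C * (1 + ‖z‖) ^ A * rexp (L * |z.im|)) (k : ℕ) {η : ℝ} (hη : 0 < η)
    (hη1 : η ≤ 1) : ∃ C', 0 ≤ C' ∧ ∀ z : ℂ,
      ‖z ^ k * (G z * entireSinc (η * z) ^ (k + A + 2))‖ ≤
        C' * rexp ((L + (k + A + 2 : ℕ) * η) * |z.im|) / (1 + ‖z‖) ^ 2 := by
  obtain ⟨S, hS0, hS⟩ := exists_norm_entireSinc_le
  refine ⟨C * (S / η) ^ (k + A + 2), by positivity, fun z => ?_⟩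
  have hz := norm_nonneg z
  have h1 : ‖entireSinc (η * z)‖ ≤ S / η * rexp (η * |z.im|) / (1 + ‖z‖) := by
    refine (hS (η * z)).trans ?_
    have e1 : |((η : ℂ) * z).im| = η * |z.im| := by simp [abs_mul, abs_of_pos hη]
    have e2 : ‖(η : ℂ) * z‖ = η * ‖z‖ := by simp [abs_of_pos hη]
    rw [e1, e2, div_mul_eq_mul_div, div_div]
    gcongr
    nlinarith
  rw [norm_mul, norm_mul, norm_pow, norm_pow]
  calc ‖z‖ ^ k * (‖G z‖ * ‖entireSinc (η * z)‖ ^ (k + A + 2))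
      ≤ (1 + ‖z‖) ^ k * (C * (1 + ‖z‖) ^ A * rexp (L * |z.im|) *
        (S / η * rexp (η * |z.im|) / (1 + ‖z‖)) ^ (k + A + 2)) := by
        gcongr
        · linarith
        · exact hgrow z
    _ = C * (S / η) ^ (k + A + 2) * (rexp (L * |z.im|) * rexp (η * |z.im|) ^ (k + A + 2)) *
        ((1 + ‖z‖) ^ k * (1 + ‖z‖) ^ A / (1 + ‖z‖) ^ (k + A + 2)) := by
        rw [div_pow, mul_pow]
        ring
    _ = _ := by
        rw [← Real.exp_nat_mul, ← Real.exp_add]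
        have e3 : (1 + ‖z‖) ^ k * (1 + ‖z‖) ^ A / (1 + ‖z‖) ^ (k + A + 2) =
            1 / (1 + ‖z‖) ^ 2 := by
          rw [pow_add, pow_add]
          field_simp
        rw [e3, add_mul, mul_assoc ((k + A + 2 : ℕ) : ℝ) η, mul_one_div]

/-- The Hankel-type integral of an even entire function of exponential type at most `λ` that
decays on the real axis depends only on its value at the origin. -/
lemma integral_besselJ_mul_of_growth_of_decay {G : ℂ → ℂ} (hG : Differentiable ℂ G)
    (heven : ∀ z, G (-z) = G z) (m : ℕ) {C L lam : ℝ} {A : ℕ} (hC : 0 ≤ C) (hL : 0 ≤ L)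
    (hlam : 0 < lam) (hl : L ≤ lam)
    (hgrow : ∀ z, ‖G z‖ ≤ C * (1 + ‖z‖) ^ A * rexp (L * |z.im|))
    {K p : ℝ} (hK : 0 ≤ K) (hdecay : ∀ x : ℝ, 0 ≤ x → ‖G x‖ ≤ K * (1 + x) ^ p)
    (hp : 2 * m + p < -(1 / 2)) :
    ∫ x in Set.Ioi (0 : ℝ), besselJ (2 * m + 1) (lam * x) * ((x : ℂ) ^ (2 * m) * G x) =
      (2 * m).factorial / 2 * (2 / lam) ^ (2 * m + 1) * G 0 := by
  obtain ⟨B, hB0, hB⟩ := exists_abs_besselJ_le (2 * m + 1)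
  have hJ := continuous_besselJ (2 * m + 1)
  have hS := differentiable_entireSinc.continuous
  have hGc := hG.continuous
  have hlam' : (lam : ℂ) ≠ 0 := by exact_mod_cast hlam.ne'
  set N := 2 * m + A + 2 with hN
  have hpos : ∀ᶠ δ : ℝ in nhdsWithin 0 (Set.Ioi 0), 0 < δ := self_mem_nhdsWithin
  have hlt : ∀ᶠ δ : ℝ in nhdsWithin 0 (Set.Ioi 0), δ < 1 :=
    nhdsWithin_le_nhds (Iio_mem_nhds one_pos)
  set D : ℝ → ℝ → ℂ := fun δ x => besselJ (2 * m + 1) ((lam + δ) * x) *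
    ((x : ℂ) ^ (2 * m) * (G x * entireSinc ((δ / (N + 1) : ℝ) * x) ^ N)) with hD
  have lim1 : Filter.Tendsto (fun δ : ℝ => ∫ x in Set.Ioi (0 : ℝ), D δ x)
      (nhdsWithin 0 (Set.Ioi 0)) (nhds (∫ x in Set.Ioi (0 : ℝ),
        besselJ (2 * m + 1) (lam * x) * ((x : ℂ) ^ (2 * m) * G x))) := by
    refine tendsto_integral_filter_of_dominated_convergence
      (fun x => B * lam ^ (-(1 / 2) : ℝ) * K * (x ^ (-(1 / 2) : ℝ) * (1 + x) ^ (2 * m + p)))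
      ?_ ?_ ((integrableOn_rpow_neg_half_mul_one_add_rpow hp).const_mul _) ?_
    · exact .of_forall fun δ => Continuous.aestronglyMeasurable (by rw [hD]; fun_prop)
    · filter_upwards [hpos] with δ hδ
      refine (ae_restrict_iff' measurableSet_Ioi).2 (.of_forall fun x hx => ?_)
      have hx0 : 0 < x := hx
      rw [hD]
      simp only [norm_mul, norm_pow, Complex.norm_real, Real.norm_eq_abs, abs_of_pos hx0]
      have b1 : |besselJ (2 * m + 1) ((lam + δ) * x)| ≤
          B * (lam ^ (-(1 / 2) : ℝ) * x ^ (-(1 / 2) : ℝ)) := by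
        refine (hB _ (by positivity)).trans ?_
        rw [← Real.mul_rpow hlam.le hx0.le]
        refine mul_le_mul_of_nonneg_left ?_ hB0
        refine Real.rpow_le_rpow_of_nonpos (by positivity) ?_ (by norm_num)
        nlinarith
      have b2 : ‖entireSinc ((δ / (N + 1) : ℝ) * x)‖ ≤ 1 := by
        rw [← Complex.ofReal_mul]
        exact norm_entireSinc_ofReal_le _
      have b3 : x ^ (2 * m) ≤ (1 + x) ^ (2 * m) := by
        gcongr
        linarith
      have b4 : (1 + x) ^ (2 * m + p) = (1 + x) ^ (2 * m) * (1 + x) ^ p := by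
        rw [Real.rpow_add (by positivity)]
        norm_cast
      calc _ ≤ B * (lam ^ (-(1 / 2) : ℝ) * x ^ (-(1 / 2) : ℝ)) *
            ((1 + x) ^ (2 * m) * (K * (1 + x) ^ p * 1 ^ N)) := by
            gcongr
            exact hdecay x hx0.le
        _ = _ := by rw [b4, one_pow]; ring
    · refine .of_forall fun x => ?_
      have hc0 : Continuous fun δ : ℝ => D δ x := by
        rw [hD]
        fun_prop
      have := (hc0.tendsto 0).mono_left (nhdsWithin_le_nhds (s := Set.Ioi 0))
      simpa [hD, entireSinc_zero] using this
  have lim2 : Filter.Tendsto (fun δ : ℝ =>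
      ((2 * m).factorial / 2 * (2 / (lam + δ : ℝ)) ^ (2 * m + 1) * G 0 : ℂ))
      (nhdsWithin 0 (Set.Ioi 0))
      (nhds ((2 * m).factorial / 2 * (2 / lam) ^ (2 * m + 1) * G 0)) := by
    have hat : ContinuousAt (fun δ : ℝ =>
        ((2 * m).factorial / 2 * (2 / (lam + δ : ℝ)) ^ (2 * m + 1) * G 0 : ℂ)) 0 := by
      refine ContinuousAt.mul (continuousAt_const.mul (ContinuousAt.pow ?_ _)) continuousAt_const
      exact continuousAt_const.div (by fun_prop) (by simpa using hlam')
    simpa using hat.tendsto.mono_left (nhdsWithin_le_nhds (s := Set.Ioi 0))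
  refine tendsto_nhds_unique lim1 (lim2.congr' ?_)
  filter_upwards [hpos, hlt] with δ hδ hδ1
  have hη : 0 < δ / (N + 1) := by positivity
  have hη1 : δ / (N + 1) ≤ 1 := by
    rw [div_le_one (by positivity)]
    have : (0 : ℝ) ≤ N := by positivity
    linarith
  obtain ⟨C', hC', hbound⟩ := norm_mul_entireSinc_pow_le hC hgrow (2 * m) hη hη1
  have hLt : L + (N : ℝ) * (δ / (N + 1)) < lam + δ := by
    have : (N : ℝ) * (δ / (N + 1)) < δ := by
      rw [mul_div_assoc', div_lt_iff₀ (by positivity)]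
      nlinarith
    linarith
  have := integral_besselJ_mul_of_exponential_type
    (G := fun z => G z * entireSinc ((δ / (N + 1) : ℝ) * z) ^ N)
    (by have := differentiable_entireSinc; fun_prop)
    (fun z => by simp only [heven, mul_neg, entireSinc_neg]) m hC' (by positivity) hLt hbound
  rw [hD, this]
  simp [entireSinc_zero]

lemma exists_norm_prod_invGammaPair_le (s : Finset ℕ) {α β : ℕ → ℝ}
    (hα : ∀ k ∈ s, 0 < α k) (hβ : ∀ k ∈ s, 0 < β k) :
    ∃ C, ∃ A : ℕ, 0 ≤ C ∧ ∀ z : ℂ, ‖∏ k ∈ s, invGammaPair (α k) (β k * z)‖ ≤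
      C * (1 + ‖z‖) ^ A * rexp (π * (∑ k ∈ s, β k) * |z.im|) := by
  induction s using Finset.induction_on with
  | empty => exact ⟨1, 0, zero_le_one, by simp⟩
  | insert k s hk ih =>
    simp only [Finset.mem_insert, forall_eq_or_imp] at hα hβ
    obtain ⟨C, A, hC, h⟩ := ih hα.2 hβ.2
    obtain ⟨C₁, A₁, hC₁, h₁⟩ := growthPi hα.1.le
    have hb := hβ.1
    refine ⟨C₁ * (1 + β k) ^ A₁ * C, A₁ + A, by positivity, fun z => ?_⟩
    rw [Finset.prod_insert hk, Finset.sum_insert hk, norm_mul]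
    have e1 : |((β k : ℂ) * z).im| = β k * |z.im| := by simp [abs_mul, abs_of_pos hb]
    have e2 : ‖(β k : ℂ) * z‖ = β k * ‖z‖ := by simp [abs_of_pos hb]
    have h₂ := h₁ (β k * z)
    rw [e1, e2] at h₂
    have hz := norm_nonneg z
    calc _ ≤ C₁ * ((1 + β k) * (1 + ‖z‖)) ^ A₁ * rexp (π * (β k * |z.im|)) *
          (C * (1 + ‖z‖) ^ A * rexp (π * (∑ k ∈ s, β k) * |z.im|)) := by
          refine mul_le_mul (h₂.trans ?_) (h z) (norm_nonneg _) (by positivity)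
          gcongr
          nlinarith
      _ = C₁ * (1 + β k) ^ A₁ * C * (1 + ‖z‖) ^ (A₁ + A) *
          (rexp (π * (β k * |z.im|)) * rexp (π * (∑ k ∈ s, β k) * |z.im|)) := by
          rw [mul_pow, pow_add]
          ring
      _ = _ := by
          rw [← Real.exp_add]
          ring_nf

lemma exists_one_add_mul_rpow_le {b : ℝ} (hb : 0 < b) (p : ℝ) :
    ∃ C, 0 ≤ C ∧ ∀ x : ℝ, 0 ≤ x → (1 + b * x) ^ p ≤ C * (1 + x) ^ p := by
  refine ⟨max ((1 + b) ^ p) ((b / (1 + b)) ^ p), by positivity, fun x hx => ?_⟩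
  rcases le_total 0 p with hp | hp
  · calc (1 + b * x) ^ p ≤ ((1 + b) * (1 + x)) ^ p := by
          gcongr
          nlinarith
      _ = (1 + b) ^ p * (1 + x) ^ p := Real.mul_rpow (by positivity) (by positivity)
      _ ≤ _ := by
          gcongr
          exact le_max_left _ _
  · calc (1 + b * x) ^ p ≤ (b / (1 + b) * (1 + x)) ^ p := by
          refine Real.rpow_le_rpow_of_nonpos (by positivity) ?_ hp
          rw [div_mul_eq_mul_div, div_le_iff₀ (by positivity)]
          nlinarith [mul_nonneg hb.le (mul_nonneg hb.le hx)]
      _ = (b / (1 + b)) ^ p * (1 + x) ^ p := Real.mul_rpow (by positivity) (by positivity)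
      _ ≤ _ := by
          gcongr
          exact le_max_right _ _

lemma exists_norm_prod_invGammaPair_ofReal_le (s : Finset ℕ) {α β : ℕ → ℝ}
    (hα : ∀ k ∈ s, 0 < α k) (hβ : ∀ k ∈ s, 0 < β k) :
    ∃ C, 0 ≤ C ∧ ∀ x : ℝ, 0 ≤ x → ‖∏ k ∈ s, invGammaPair (α k) (β k * x)‖ ≤
      C * (1 + x) ^ (s.card - 2 * ∑ k ∈ s, α k) := by
  induction s using Finset.induction_on with
  | empty => exact ⟨1, zero_le_one, by simp⟩
  | insert k s hk ih =>
    simp only [Finset.mem_insert, forall_eq_or_imp] at hα hβ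
    obtain ⟨C, hC, h⟩ := ih hα.2 hβ.2
    obtain ⟨C₁, hC₁, h₁⟩ := decayReal hα.1.le
    have hb := hβ.1
    obtain ⟨C₂, hC₂, h₂⟩ := exists_one_add_mul_rpow_le hb (1 - 2 * α k)
    refine ⟨C₁ * C₂ * C, by positivity, fun x hx => ?_⟩
    rw [Finset.prod_insert hk, Finset.sum_insert hk, Finset.card_insert_of_notMem hk, norm_mul]
    have h₃ := h₁ (β k * x) (by positivity)
    rw [Complex.ofReal_mul] at h₃
    calc _ ≤ C₁ * (C₂ * (1 + x) ^ (1 - 2 * α k)) *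
          (C * (1 + x) ^ (s.card - 2 * ∑ k ∈ s, α k)) := by
          refine mul_le_mul (h₃.trans ?_) (h x hx) (norm_nonneg _) (by positivity)
          gcongr
          exact h₂ x hx
      _ = C₁ * C₂ * C * ((1 + x) ^ (1 - 2 * α k) * (1 + x) ^ (s.card - 2 * ∑ k ∈ s, α k)) := by
          ring
      _ = _ := by
          rw [← Real.rpow_add (by positivity)]
          push_cast
          ring_nf

lemma ofReal_gammaProd (M : ℕ) (α β : ℕ → ℝ) (x : ℝ) :
    (gammaProd M α β x : ℂ) = ∏ k ∈ Finset.range M, invGammaPair (α k) (β k * x) := by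
  rw [gammaProd, Complex.ofReal_prod]
  refine Finset.prod_congr rfl fun k _ => ?_
  rw [invGammaPair, mul_inv, Complex.ofReal_mul, Complex.ofReal_inv, Complex.ofReal_inv,
    ← Complex.Gamma_ofReal, ← Complex.Gamma_ofReal]
  push_cast
  rfl

theorem hankel_gamma_first_term_odd_order
    (M : ℕ) (hM : 1 ≤ M) (α β : ℕ → ℝ)
    (hα : ∀ k ∈ Finset.range M, 0 < α k) (hβ : ∀ k ∈ Finset.range M, 0 < β k)
    (m : ℕ)
    (hαsum : (m : ℝ) + (1 / 2) * ((M : ℝ) + 1 / 2) < ∑ k ∈ Finset.range M, α k)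
    (lam : ℝ) (hlam : π * ∑ k ∈ Finset.range M, β k ≤ lam) :
    ∫ x in Set.Ioi (0 : ℝ), x ^ (2 * m) * besselJ (2 * m + 1) (lam * x) * gammaProd M α β x
      = ((Nat.factorial (2 * m) : ℝ) / (2 * ∏ k ∈ Finset.range M, (Real.Gamma (α k)) ^ 2))
          * (2 / lam) ^ (2 * m + 1) := by
  have hβsum : 0 < ∑ k ∈ Finset.range M, β k :=
    Finset.sum_pos hβ (Finset.nonempty_range_iff.2 (by omega))
  have hL : 0 < π * ∑ k ∈ Finset.range M, β k := mul_pos Real.pi_pos hβsum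
  obtain ⟨C, A, hC, hgrow⟩ := exists_norm_prod_invGammaPair_le _ hα hβ
  obtain ⟨K, hK, hdecay⟩ := exists_norm_prod_invGammaPair_ofReal_le _ hα hβ
  have hd : Differentiable ℂ fun z : ℂ =>
      ∏ k ∈ Finset.range M, invGammaPair (α k) (β k * z) := by
    refine Differentiable.fun_finsetProd fun k _ => ?_
    exact (differentiable_invGammaPair (α k)).comp (differentiable_id.const_mul _)
  have hmain := integral_besselJ_mul_of_growth_of_decay hd
    (fun z => by simp only [mul_neg, invGammaPair_neg]) m hC hL.le (hL.trans_le hlam) hlam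
    hgrow hK hdecay (by rw [Finset.card_range]; linarith)
  have h0 : ∏ k ∈ Finset.range M, invGammaPair (α k) (β k * 0) =
      ((∏ k ∈ Finset.range M, Real.Gamma (α k) ^ 2 : ℝ) : ℂ)⁻¹ := by
    rw [Complex.ofReal_prod, ← Finset.prod_inv_distrib]
    refine Finset.prod_congr rfl fun k _ => ?_
    rw [invGammaPair, mul_zero, add_zero, sub_zero, Complex.Gamma_ofReal, ← mul_inv,
      Complex.ofReal_pow, sq]
  rw [h0] at hmain
  apply Complex.ofReal_injective
  rw [← integral_complex_ofReal]
  have hcast : ∀ x : ℝ, ((x ^ (2 * m) * besselJ (2 * m + 1) (lam * x) * gammaProd M α β x : ℝ) : ℂ) =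
      besselJ (2 * m + 1) (lam * x) * ((x : ℂ) ^ (2 * m) *
        ∏ k ∈ Finset.range M, invGammaPair (α k) (β k * x)) := by
    intro x
    rw [← ofReal_gammaProd]
    push_cast
    ring
  simp only [hcast]
  rw [hmain]
  push_cast
  rw [div_mul_eq_div_div, div_eq_mul_inv _ (∏ k ∈ Finset.range M, _)]
  ring
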